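/- arXiv:1711.04639 — 12 statements merged into one kernel-verified Lean document; each statement's English description precedes it below -/
import Mathlib

section
/- Let n be a natural number, v : Fin n → ZMod 2 and σ ∈ Equiv.Perm (Fin n), and let f_{v,σ} ∈ Equiv.Perm (Fin n × ZMod 2) be the permutation (i, ε) ↦ (σ i, ε + v i). Then f_{v,σ} lies in Bₙ, its sign as a permutation of Fin n × ZMod 2 equals (−1) raised to the number of indices i with v i = 1, and consequently f_{v,σ} lies in Dₙ' if and only if the number of indices i with v i = 1 is even. -/
/-- The global sign change ν : (i, ε) ↦ (i, ε + 1). -/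
def negPerm (n : ℕ) : Equiv.Perm (Fin n × ZMod 2) :=
  Equiv.prodCongr (Equiv.refl (Fin n)) (Equiv.addRight (1 : ZMod 2))

/-- The hyperoctahedral group `Bₙ`: the permutations of `Fin n × ZMod 2` commuting with ν. -/
def hyperB (n : ℕ) : Subgroup (Equiv.Perm (Fin n × ZMod 2)) :=
  Subgroup.centralizer {negPerm n}

/-- The group `Dₙ'` of even signed permutations. -/
def hyperD (n : ℕ) : Subgroup (Equiv.Perm (Fin n × ZMod 2)) :=
  hyperB n ⊓ alternatingGroup (Fin n × ZMod 2)

/-- The signed permutation `f_{v,σ} : (i, ε) ↦ (σ i, ε + v i)`. -/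
def signedPerm (n : ℕ) (v : Fin n → ZMod 2) (σ : Equiv.Perm (Fin n)) :
    Equiv.Perm (Fin n × ZMod 2) where
  toFun p := (σ p.1, p.2 + v p.1)
  invFun p := (σ.symm p.1, p.2 + v (σ.symm p.1))
  left_inv p := by
    have h : ∀ a : ZMod 2, a + a = 0 := by decide
    obtain ⟨i, ε⟩ := p
    simp [add_assoc, h]
  right_inv p := by
    have h : ∀ a : ZMod 2, a + a = 0 := by decide
    obtain ⟨i, ε⟩ := p
    simp [add_assoc, h]

/-- `f_{v,σ}` lies in `Bₙ`, its sign is `(-1)` to the number of indices `i` with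
`v i = 1`, and it lies in `Dₙ'` iff that number is even. -/
theorem signedPerm_mem_hyperB_sign_and_mem_hyperD_iff
    (n : ℕ) (v : Fin n → ZMod 2) (σ : Equiv.Perm (Fin n)) :
    signedPerm n v σ ∈ hyperB n ∧
    Equiv.Perm.sign (signedPerm n v σ)
      = (-1) ^ (Finset.univ.filter fun i => v i = 1).card ∧
    (signedPerm n v σ ∈ hyperD n ↔ Even (Finset.univ.filter fun i => v i = 1).card) := by
  have hB : signedPerm n v σ ∈ hyperB n := by
    rw [hyperB, Subgroup.mem_centralizer_iff]
    intro h hh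
    rw [Set.mem_singleton_iff] at hh
    subst hh
    refine Equiv.ext ?_
    rintro ⟨i, e⟩
    refine Prod.ext rfl ?_
    change e + v i + 1 = e + 1 + v i
    ring
  have hS : Equiv.Perm.sign (signedPerm n v σ)
      = (-1) ^ (Finset.univ.filter fun i => v i = 1).card := by
    have hdec : signedPerm n v σ = Equiv.prodCongrLeft (fun _ : ZMod 2 => σ) *
        Equiv.prodCongrRight (fun i : Fin n => Equiv.addRight (v i)) := by
      refine Equiv.ext ?_
      rintro ⟨i, e⟩
      rfl
    have hs : ∀ a : ZMod 2, Equiv.Perm.sign (Equiv.addRight a) = if a = 1 then -1 else 1 := by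
      decide
    have hc : Fintype.card (ZMod 2) = 2 := ZMod.card 2
    rw [hdec, Equiv.Perm.sign_mul, Equiv.Perm.sign_prodCongrLeft,
      Equiv.Perm.sign_prodCongrRight, Finset.prod_const, Finset.card_univ, hc,
      Int.units_sq, one_mul]
    simp only [hs]
    rw [Finset.prod_ite, Finset.prod_const, Finset.prod_const_one, mul_one]
  refine ⟨hB, hS, ?_⟩
  rw [hyperD, Subgroup.mem_inf, Equiv.Perm.mem_alternatingGroup, hS]
  rw [neg_one_pow_eq_one_iff_even (by decide)]
  exact and_iff_right hB
end

section
/- Let n ≥ 2. In Equiv.Perm (Fin n × ZMod 2), conjugation by s₀ satisfies: s₀ * t₁ * s₀⁻¹ = t₀, s₀ * t₀ * s₀⁻¹ = t₁, and s₀ * tᵢ * s₀⁻¹ = tᵢ for every i with 2 ≤ i ≤ n − 1. (Conjugation by s₀ acts on Dₙ by switching the Coxeter generators t₀ and t₁ and fixing tᵢ for i ≥ 2.) -/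
/-- The sign change in the first coordinate, `s₀ = swap (0,0) (0,1)`. -/
def sZero (n : ℕ) (hn : 1 ≤ n) : Equiv.Perm (Fin n × ZMod 2) :=
  Equiv.swap ((⟨0, hn⟩ : Fin n), (0 : ZMod 2)) (⟨0, hn⟩, (1 : ZMod 2))

/-- For `1 ≤ i ≤ n - 1`, the Coxeter generator
`tᵢ = swap (i-1,0) (i,0) * swap (i-1,1) (i,1)`. -/
def tGen (n : ℕ) (i : ℕ) (_h1 : 1 ≤ i) (h2 : i < n) : Equiv.Perm (Fin n × ZMod 2) :=
  Equiv.swap ((⟨i - 1, Nat.lt_of_le_of_lt (Nat.sub_le i 1) h2⟩ : Fin n), (0 : ZMod 2))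
      (⟨i, h2⟩, (0 : ZMod 2)) *
    Equiv.swap ((⟨i - 1, Nat.lt_of_le_of_lt (Nat.sub_le i 1) h2⟩ : Fin n), (1 : ZMod 2))
      (⟨i, h2⟩, (1 : ZMod 2))

/-- The Coxeter generator `t₀ = swap (0,0) (1,1) * swap (0,1) (1,0)` of type D. -/
def tZero (n : ℕ) (hn : 2 ≤ n) : Equiv.Perm (Fin n × ZMod 2) :=
  Equiv.swap ((⟨0, Nat.lt_of_lt_of_le Nat.zero_lt_two hn⟩ : Fin n), (0 : ZMod 2))
      (⟨1, hn⟩, (1 : ZMod 2)) *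
    Equiv.swap ((⟨0, Nat.lt_of_lt_of_le Nat.zero_lt_two hn⟩ : Fin n), (1 : ZMod 2))
      (⟨1, hn⟩, (0 : ZMod 2))

theorem conj_two_swaps {α : Type*} [DecidableEq α] (σ : Equiv.Perm α) (a b c d : α) :
    σ * (Equiv.swap a b * Equiv.swap c d) * σ⁻¹ =
      Equiv.swap (σ a) (σ b) * Equiv.swap (σ c) (σ d) := by
  rw [Equiv.swap_apply_apply, Equiv.swap_apply_apply]
  group

theorem swaps_comm {α : Type*} [DecidableEq α] (a b c d : α)
    (h1 : a ≠ c) (h2 : a ≠ d) (h3 : b ≠ c) (h4 : b ≠ d) :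
    Equiv.swap a b * Equiv.swap c d = Equiv.swap c d * Equiv.swap a b := by
  ext x
  simp only [Equiv.Perm.mul_apply, Equiv.swap_apply_def]
  grind

theorem sZero_zero (n : ℕ) (hn : 1 ≤ n) : sZero n hn (⟨0, hn⟩, 0) = (⟨0, hn⟩, 1) :=
  Equiv.swap_apply_left _ _

theorem sZero_one (n : ℕ) (hn : 1 ≤ n) : sZero n hn (⟨0, hn⟩, 1) = (⟨0, hn⟩, 0) :=
  Equiv.swap_apply_right _ _

theorem sZero_ne (n : ℕ) (hn : 1 ≤ n) (k : ℕ) (hk : k < n) (h : k ≠ 0) (e : ZMod 2) :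
    sZero n hn (⟨k, hk⟩, e) = (⟨k, hk⟩, e) := by
  apply Equiv.swap_apply_of_ne_of_ne <;> simp [h]

/-- conjugation by `s₀` switches the type-D Coxeter generators `t₀` and `t₁` and
fixes `tᵢ` for `2 ≤ i ≤ n - 1`. -/
theorem sZero_conj_tGen (n : ℕ) (hn : 2 ≤ n) :
    sZero n (Nat.le_trans one_le_two hn) * tGen n 1 le_rfl hn *
        (sZero n (Nat.le_trans one_le_two hn))⁻¹ = tZero n hn ∧
    sZero n (Nat.le_trans one_le_two hn) * tZero n hn *
        (sZero n (Nat.le_trans one_le_two hn))⁻¹ = tGen n 1 le_rfl hn ∧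
    (∀ (i : ℕ) (h1 : 2 ≤ i) (h2 : i ≤ n - 1),
      sZero n (Nat.le_trans one_le_two hn) *
          tGen n i (Nat.le_trans one_le_two h1) (by omega) *
          (sZero n (Nat.le_trans one_le_two hn))⁻¹
        = tGen n i (Nat.le_trans one_le_two h1) (by omega)) := by
  refine ⟨?_, ?_, ?_⟩
  · unfold tGen tZero
    rw [conj_two_swaps]
    simp only [Nat.sub_self]
    rw [sZero_zero, sZero_one, sZero_ne _ _ _ _ one_ne_zero, sZero_ne _ _ _ _ one_ne_zero]
    apply swaps_comm <;> simp
  · unfold tGen tZero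
    rw [conj_two_swaps]
    simp only [Nat.sub_self]
    rw [sZero_zero, sZero_one, sZero_ne _ _ _ _ one_ne_zero, sZero_ne _ _ _ _ one_ne_zero]
    apply swaps_comm <;> simp
  · intro i h1 h2
    unfold tGen
    have h3 : i ≠ 0 := by omega
    have h4 : i - 1 ≠ 0 := by omega
    rw [conj_two_swaps, sZero_ne _ _ _ _ h3, sZero_ne _ _ _ _ h3,
      sZero_ne _ _ _ _ h4, sZero_ne _ _ _ _ h4]
end

section
/- Let α be a nonempty finite type. There exists a subgroup P of Equiv.Perm α which acts transitively on α and satisfies g ^ 2 = 1 for all g ∈ P if and only if the cardinality of α is a power of 2. (The symmetric group Σₙ admits a transitive elementary abelian 2-subgroup if and only if n = 2ᵏ.) -/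
/-- A nonempty finite type admits a transitive elementary abelian 2-subgroup of
its symmetric group if and only if its cardinality is a power of 2. -/
theorem exists_transitive_elementary_abelian_two_subgroup_iff_card_pow_two
    (α : Type*) [Fintype α] [Nonempty α] :
    (∃ P : Subgroup (Equiv.Perm α),
        (∀ g ∈ P, g ^ 2 = 1) ∧ (∀ a b : α, ∃ g ∈ P, g a = b)) ↔
      ∃ k : ℕ, Fintype.card α = 2 ^ k := by
  constructor
  · rintro ⟨P, h2, ht⟩
    have hP : IsPGroup 2 P := fun g => ⟨1, by
      ext1
      simpa using h2 g g.2⟩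
    obtain ⟨a⟩ := ‹Nonempty α›
    have : Fact (Nat.Prime 2) := ⟨Nat.prime_two⟩
    obtain ⟨n, hn⟩ := hP.card_orbit a
    have ho : MulAction.orbit P a = Set.univ := by
      ext b
      obtain ⟨g, hg, hb⟩ := ht a b
      simp only [Set.mem_univ, iff_true]
      exact ⟨⟨g, hg⟩, hb⟩
    refine ⟨n, ?_⟩
    rw [← hn, ho, Nat.card_coe_set_eq, Set.ncard_univ, Nat.card_eq_fintype_card]
  · rintro ⟨k, hk⟩
    have e : α ≃ (Fin k → ZMod 2) := Fintype.equivOfCardEq (by simp [hk])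
    have hv : ∀ v : Fin k → ZMod 2, v + v = 0 := fun v => by
      ext i
      exact CharTwo.add_self_eq_zero (v i)
    refine ⟨{ carrier := {g | ∃ v, ∀ a, e (g a) = v + e a}
              one_mem' := ⟨0, by simp⟩
              mul_mem' := ?_
              inv_mem' := ?_ }, ?_, ?_⟩
    · rintro g h ⟨v, hg⟩ ⟨w, hh⟩
      exact ⟨v + w, fun a => by rw [Equiv.Perm.mul_apply, hg, hh, add_assoc]⟩
    · rintro g ⟨v, hg⟩
      refine ⟨v, fun a => ?_⟩
      have := hg (g⁻¹ a)
      rw [← Equiv.Perm.mul_apply, mul_inv_cancel, Equiv.Perm.one_apply] at this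
      rw [this, ← add_assoc, hv, zero_add]
    · rintro g ⟨v, hg⟩
      ext a
      apply e.injective
      rw [pow_two, Equiv.Perm.mul_apply, hg, hg, ← add_assoc, hv, zero_add, Equiv.Perm.one_apply]
    · intro a b
      refine ⟨(e.trans (Equiv.addLeft (e b - e a))).trans e.symm, ⟨e b - e a, ?_⟩, ?_⟩
      · intro c
        simp
      · simp
end

section
/- Let α be a finite type, and let P and Q be subgroups of Equiv.Perm α, each acting transitively on α and each satisfying g ^ 2 = 1 for all of its elements. Then P and Q are conjugate in Equiv.Perm α: there exists h ∈ Equiv.Perm α with h * P * h⁻¹ = Q (as subgroups). (All transitive elementary abelian 2-subgroups of Σ_{2ᵏ} are conjugate to the subgroup Vₖ given by the regular action of (ℤ/2)ᵏ on itself.) -/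
theorem aux_comm {G : Type*} [Group G] (h : ∀ g : G, g ^ 2 = 1) (a b : G) : a * b = b * a := by
  have inv : ∀ g : G, g⁻¹ = g := fun g => inv_eq_of_mul_eq_one_left (by rw [← pow_two]; exact h g)
  have := inv (a * b)
  rw [mul_inv_rev, inv, inv] at this
  exact this.symm

theorem aux_iso_add {G H : Type*} [AddCommGroup G] [AddCommGroup H] [Finite G] [Finite H]
    (hG : ∀ g : G, 2 • g = 0) (hH : ∀ g : H, 2 • g = 0) (hc : Nat.card G = Nat.card H) :
    Nonempty (G ≃+ H) := by
  letI : Module (ZMod 2) G := AddCommGroup.zmodModule hG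
  letI : Module (ZMod 2) H := AddCommGroup.zmodModule hH
  letI := Fintype.ofFinite G
  letI := Fintype.ofFinite H
  haveI : Fact (Nat.Prime 2) := ⟨Nat.prime_two⟩
  have h1 := Module.card_eq_pow_finrank (K := ZMod 2) (V := G)
  have h2 := Module.card_eq_pow_finrank (K := ZMod 2) (V := H)
  rw [Nat.card_eq_fintype_card, Nat.card_eq_fintype_card, h1, h2, ZMod.card] at hc
  have h3 := Nat.pow_right_injective (le_refl 2) hc
  obtain ⟨e⟩ := FiniteDimensional.nonempty_linearEquiv_of_finrank_eq h3
  exact ⟨e.toAddEquiv⟩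

theorem aux_iso {G H : Type*} [Group G] [Group H] [Finite G] [Finite H]
    (hG : ∀ g : G, g ^ 2 = 1) (hH : ∀ g : H, g ^ 2 = 1) (hc : Nat.card G = Nat.card H) :
    Nonempty (G ≃* H) := by
  letI : CommGroup G := { mul_comm := aux_comm hG }
  letI : CommGroup H := { mul_comm := aux_comm hH }
  obtain ⟨e⟩ := aux_iso_add (G := Additive G) (H := Additive H) hG hH hc
  exact ⟨MulEquiv.toAdditive.symm e⟩

theorem aux_bij {α : Type*} (P : Subgroup (Equiv.Perm α))
    (hPsq : ∀ g ∈ P, g ^ 2 = 1) (hPtrans : ∀ a b : α, ∃ g ∈ P, g a = b) (a : α) :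
    Function.Bijective (fun g : P => g.1 a) := by
  have hc : ∀ x y : P, x * y = y * x := aux_comm (fun g => Subtype.ext (hPsq g.1 g.2))
  constructor
  · intro x y hxy
    ext b
    obtain ⟨g, hg, rfl⟩ := hPtrans a b
    have h1 := congrArg (fun z : P => z.1 a) (hc x ⟨g, hg⟩)
    have h2 := congrArg (fun z : P => z.1 a) (hc y ⟨g, hg⟩)
    simp only [Subgroup.coe_mul, Equiv.Perm.mul_apply] at h1 h2 hxy
    rw [h1, h2, hxy]
  · intro b
    obtain ⟨g, hg, h⟩ := hPtrans a b
    exact ⟨⟨g, hg⟩, h⟩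

/-- Any two transitive elementary abelian 2-subgroups of the symmetric group of a
finite type are conjugate. -/
theorem transitive_elementary_abelian_two_subgroups_isConj
    (α : Type*) [Fintype α]
    (P Q : Subgroup (Equiv.Perm α))
    (hPsq : ∀ g ∈ P, g ^ 2 = 1) (hPtrans : ∀ a b : α, ∃ g ∈ P, g a = b)
    (hQsq : ∀ g ∈ Q, g ^ 2 = 1) (hQtrans : ∀ a b : α, ∃ g ∈ Q, g a = b) :
    ∃ h : Equiv.Perm α, Subgroup.map (MulAut.conj h).toMonoidHom P = Q := by
  rcases isEmpty_or_nonempty α with hα | ⟨⟨a⟩⟩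
  · exact ⟨1, Subsingleton.elim _ _⟩
  let eP := Equiv.ofBijective _ (aux_bij P hPsq hPtrans a)
  let eQ := Equiv.ofBijective _ (aux_bij Q hQsq hQtrans a)
  obtain ⟨φ⟩ := aux_iso (G := P) (H := Q) (fun g => Subtype.ext (hPsq g.1 g.2))
    (fun g => Subtype.ext (hQsq g.1 g.2)) (Nat.card_congr (eP.trans eQ.symm))
  let h : Equiv.Perm α := (eP.symm.trans φ.toEquiv).trans eQ
  have hh : ∀ g : P, h (g.1 a) = (φ g).1 a := by
    intro g
    have : eP.symm (g.1 a) = g := eP.symm_apply_apply g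
    change eQ (φ (eP.symm (g.1 a))) = _
    rw [this]
    rfl
  have key : ∀ g : P, h * g.1 * h⁻¹ = (φ g).1 := by
    intro g
    rw [mul_inv_eq_iff_eq_mul]
    ext b
    obtain ⟨k, hk, rfl⟩ := hPtrans a b
    have h1 := hh (g * ⟨k, hk⟩)
    have h2 := hh ⟨k, hk⟩
    simp only [Subgroup.coe_mul, Equiv.Perm.mul_apply, map_mul] at h1 h2 ⊢
    rw [h1, h2]
  refine ⟨h, ?_⟩
  ext x
  constructor
  · rintro ⟨g, hg, rfl⟩
    have := key ⟨g, hg⟩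
    change h * g * h⁻¹ ∈ Q
    rw [this]
    exact (φ _).2
  · intro hx
    refine ⟨(φ.symm ⟨x, hx⟩).1, (φ.symm ⟨x, hx⟩).2, ?_⟩
    change h * _ * h⁻¹ = x
    rw [key]
    simp
end

section
/- Let α be a finite type and let A be a subgroup of Equiv.Perm α which is maximal (with respect to inclusion) among the subgroups of Equiv.Perm α all of whose elements square to the identity. Then A has at most one fixed point in α, i.e. the set {a : α | ∀ g ∈ A, g a = a} has at most one element. (In the parametrization of conjugacy classes of maximal elementary abelian 2-subgroups of Σₙ by partitions of n into powers of 2, the multiplicity of 1 = 2⁰ is at most 1.) -/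
/-- A maximal elementary abelian 2-subgroup of the symmetric group of a finite type
has at most one fixed point. -/
theorem maximal_elementary_abelian_two_subgroup_fixedPoints_subsingleton
    (α : Type*) [Fintype α]
    (A : Subgroup (Equiv.Perm α))
    (hsq : ∀ g ∈ A, g ^ 2 = 1)
    (hmax : ∀ B : Subgroup (Equiv.Perm α), (∀ g ∈ B, g ^ 2 = 1) → A ≤ B → B = A) :
    {a : α | ∀ g ∈ A, g a = a}.Subsingleton := by
  classical
  intro a ha b hb
  by_contra hab
  have hc : ∀ g ∈ A, g * Equiv.swap a b = Equiv.swap a b * g := by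
    intro g hg
    rw [Equiv.mul_swap_eq_swap_mul, ha g hg, hb g hg]
  have hne : Equiv.swap a b a = b := Equiv.swap_apply_left a b
  have htt : Equiv.swap a b * Equiv.swap a b = 1 := Equiv.swap_mul_self a b
  generalize Equiv.swap a b = t at hc hne htt
  have hti : t⁻¹ = t := inv_eq_of_mul_eq_one_left htt
  let B : Subgroup (Equiv.Perm α) :=
    { carrier := {g | ∃ k ∈ A, g = k ∨ g = k * t}
      one_mem' := ⟨1, A.one_mem, Or.inl rfl⟩
      mul_mem' := by
        rintro _ _ ⟨k, hk, rfl | rfl⟩ ⟨l, hl, rfl | rfl⟩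
        · exact ⟨_, A.mul_mem hk hl, Or.inl rfl⟩
        · exact ⟨_, A.mul_mem hk hl, Or.inr (mul_assoc _ _ _).symm⟩
        · exact ⟨_, A.mul_mem hk hl, Or.inr (by rw [mul_assoc, mul_assoc, hc _ hl])⟩
        · refine ⟨_, A.mul_mem hk hl, Or.inl ?_⟩
          rw [hc _ hl, mul_assoc, ← mul_assoc t t, htt, one_mul]
      inv_mem' := by
        rintro _ ⟨k, hk, rfl | rfl⟩
        · exact ⟨_, A.inv_mem hk, Or.inl rfl⟩
        · exact ⟨_, A.inv_mem hk, Or.inr (by rw [mul_inv_rev, hti, hc _ (A.inv_mem hk)])⟩ }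
  have hB : B = A := by
    apply hmax
    · rintro _ ⟨k, hk, rfl | rfl⟩
      · exact hsq _ hk
      · have h2 : Commute k t := hc k hk
        rw [h2.mul_pow, hsq _ hk, one_mul, pow_two, htt]
    · exact fun g hg => ⟨g, hg, Or.inl rfl⟩
  have htB : t ∈ B := ⟨1, A.one_mem, Or.inr (one_mul t).symm⟩
  rw [hB] at htB
  exact hab ((ha t htB).symm.trans hne)
end

section
/- Let n ≥ 2. There exists a group homomorphism j : W(Dₙ) → W(Bₙ) satisfying j(t₀ᵂ) = s₀ᵂ * s₁ᵂ * s₀ᵂ and j(tᵢᵂ) = sᵢᵂ for all 1 ≤ i ≤ n − 1. Moreover j is injective, and its image is a normal subgroup of index 2 in W(Bₙ). -/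
/-- The Coxeter matrix of type `Bₙ` (4-labelled edge between nodes 0 and 1). -/
def MB (n : ℕ) : CoxeterMatrix (Fin n) where
  M := Matrix.of fun i j : Fin n =>
    if (i : ℕ) = (j : ℕ) then 1
    else if ((i : ℕ) = 0 ∧ (j : ℕ) = 1) ∨ ((i : ℕ) = 1 ∧ (j : ℕ) = 0) then 4
    else if (1 ≤ (i : ℕ) ∧ 1 ≤ (j : ℕ)) ∧ ((i : ℕ) + 1 = (j : ℕ) ∨ (j : ℕ) + 1 = (i : ℕ)) then 3
    else 2
  isSymm := by
    unfold Matrix.IsSymm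
    ext i j
    simp only [Matrix.transpose_apply, Matrix.of_apply]
    split_ifs <;> omega
  diagonal := by
    intro i
    simp
  off_diagonal := by
    intro i j hij
    have h : (i : ℕ) ≠ (j : ℕ) := fun h => hij (Fin.ext h)
    simp only [Matrix.of_apply]
    split_ifs <;> omega

/-- The Coxeter matrix of type `Dₙ` (fork at nodes 0, 1, 2). -/
def MD (n : ℕ) : CoxeterMatrix (Fin n) where
  M := Matrix.of fun i j : Fin n =>
    if (i : ℕ) = (j : ℕ) then 1
    else if ((i : ℕ) = 0 ∧ (j : ℕ) = 2) ∨ ((i : ℕ) = 2 ∧ (j : ℕ) = 0) ∨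
        ((i : ℕ) = 1 ∧ (j : ℕ) = 2) ∨ ((i : ℕ) = 2 ∧ (j : ℕ) = 1) ∨
        ((2 ≤ (i : ℕ) ∧ 2 ≤ (j : ℕ)) ∧ ((i : ℕ) + 1 = (j : ℕ) ∨ (j : ℕ) + 1 = (i : ℕ))) then 3
    else 2
  isSymm := by
    unfold Matrix.IsSymm
    ext i j
    simp only [Matrix.transpose_apply, Matrix.of_apply]
    split_ifs <;> omega
  diagonal := by
    intro i
    simp
  off_diagonal := by
    intro i j hij
    have h : (i : ℕ) ≠ (j : ℕ) := fun h => hij (Fin.ext h)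
    simp only [Matrix.of_apply]
    split_ifs <;> omega

section CoxAux

theorem cox_zero_lt (n : ℕ) (hn : 2 ≤ n) : 0 < n := by omega

theorem cox_one_lt (n : ℕ) (hn : 2 ≤ n) : 1 < n := by omega

theorem cox_liftable_of_lt {n : ℕ} {G : Type*} [Group G] (M : CoxeterMatrix (Fin n)) (f : Fin n → G)
    (h1 : ∀ i, f i * f i = 1) (h2 : ∀ i j : Fin n, i < j → (f i * f j) ^ M i j = 1) :
    M.IsLiftable f := by
  intro i j
  rcases lt_trichotomy i j with h | h | h
  · exact h2 i j h
  · subst h; simp [h1]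
  · have h3 := h2 j i h
    rw [M.symmetric] at h3
    have e : f i * f j = (f j * f i)⁻¹ := by
      rw [mul_inv_rev, inv_eq_of_mul_eq_one_left (h1 i), inv_eq_of_mul_eq_one_left (h1 j)]
    rw [e, inv_pow, h3, inv_one]

theorem cox_sq {n : ℕ} (M : CoxeterMatrix (Fin n)) (i : Fin n) : M.simple i * M.simple i = 1 :=
  M.toCoxeterSystem.simple_mul_simple_self i

theorem cox_pow {n : ℕ} (M : CoxeterMatrix (Fin n)) (i j : Fin n) (m : ℕ) (h : M i j = m) :
    (M.simple i * M.simple j) ^ m = 1 := by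
  subst h; exact M.toCoxeterSystem.simple_mul_simple_pow i j

theorem cox_comm {G : Type*} [Group G] {a b : G} (ha : a * a = 1) (hb : b * b = 1)
    (h : (a * b) ^ 2 = 1) : a * b = b * a := by
  rw [pow_two] at h
  rw [eq_inv_of_mul_eq_one_left h, mul_inv_rev, inv_eq_of_mul_eq_one_left ha,
    inv_eq_of_mul_eq_one_left hb]

theorem MB_apply (n : ℕ) (i j : Fin n) : MB n i j = 
    if (i : ℕ) = (j : ℕ) then 1
    else if ((i : ℕ) = 0 ∧ (j : ℕ) = 1) ∨ ((i : ℕ) = 1 ∧ (j : ℕ) = 0) then 4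
    else if (1 ≤ (i : ℕ) ∧ 1 ≤ (j : ℕ)) ∧ ((i : ℕ) + 1 = (j : ℕ) ∨ (j : ℕ) + 1 = (i : ℕ)) then 3
    else 2 := rfl

theorem MD_apply (n : ℕ) (i j : Fin n) : MD n i j = 
    if (i : ℕ) = (j : ℕ) then 1
    else if ((i : ℕ) = 0 ∧ (j : ℕ) = 2) ∨ ((i : ℕ) = 2 ∧ (j : ℕ) = 0) ∨
        ((i : ℕ) = 1 ∧ (j : ℕ) = 2) ∨ ((i : ℕ) = 2 ∧ (j : ℕ) = 1) ∨
        ((2 ≤ (i : ℕ) ∧ 2 ≤ (j : ℕ)) ∧ ((i : ℕ) + 1 = (j : ℕ) ∨ (j : ℕ) + 1 = (i : ℕ))) then 3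
    else 2 := rfl

/-- lifting with a generic statement -/
theorem cox_lift {n : ℕ} {G : Type*} [Group G] (M : CoxeterMatrix (Fin n)) (f : Fin n → G)
    (h1 : ∀ i, f i * f i = 1) (h2 : ∀ i j : Fin n, i < j → (f i * f j) ^ M i j = 1) :
    ∃ φ : M.Group →* G, ∀ i, φ (M.simple i) = f i :=
  ⟨M.toCoxeterSystem.lift ⟨f, cox_liftable_of_lt M f h1 h2⟩,
    fun i => M.toCoxeterSystem.lift_apply_simple (cox_liftable_of_lt M f h1 h2) i⟩

theorem cox_ext {n : ℕ} {G : Type*} [Group G] (M : CoxeterMatrix (Fin n)) {φ ψ : M.Group →* G}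
    (h : ∀ i, φ (M.simple i) = ψ (M.simple i)) : φ = ψ :=
  M.toCoxeterSystem.ext_simple h

/-- the map D to B -/
theorem exists_j (n : ℕ) (hn : 2 ≤ n) : ∃ j : (MD n).Group →* (MB n).Group,
    ∀ i, j ((MD n).simple i) = if (i : ℕ) = 0 then
      (MB n).simple ⟨0, cox_zero_lt n hn⟩ * (MB n).simple ⟨1, cox_one_lt n hn⟩ * (MB n).simple ⟨0, cox_zero_lt n hn⟩
      else (MB n).simple i := by
  have h0 := cox_sq (MB n) ⟨0, cox_zero_lt n hn⟩
  refine cox_lift (MD n) _ ?_ ?_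
  · intro i
    split_ifs
    · have h1 := cox_sq (MB n) ⟨1, cox_one_lt n hn⟩
      generalize (MB n).simple ⟨0, cox_zero_lt n hn⟩ = a at *
      generalize (MB n).simple ⟨1, cox_one_lt n hn⟩ = b at *
      calc a * b * a * (a * b * a) = a * b * (a * a) * b * a := by group
        _ = a * (b * b) * a := by rw [h0]; group
        _ = 1 := by rw [h1, mul_one, h0]
    · exact cox_sq _ _
  · intro i j hij
    have hij' : (i : ℕ) < j := hij
    have hj : (j : ℕ) ≠ 0 := by omega
    simp only [hj, if_false]
    by_cases hi : (i : ℕ) = 0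
    · simp only [hi, if_true]
      by_cases hj1 : (j : ℕ) = 1
      · have e : MD n i j = 2 := by rw [MD_apply]; split_ifs <;> omega
        have hj' : j = ⟨1, cox_one_lt n hn⟩ := Fin.ext hj1
        have h := cox_pow (MB n) ⟨0, cox_zero_lt n hn⟩ ⟨1, cox_one_lt n hn⟩ 4 (by simp [MB_apply])
        rw [e, hj', ← h]
        simp only [pow_succ, pow_zero, one_mul, mul_assoc]
      · have e : MD n i j = MB n ⟨1, cox_one_lt n hn⟩ j := by
          rw [MD_apply, MB_apply]; dsimp only; split_ifs <;> omega
        have c := cox_comm h0 (cox_sq (MB n) j)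
          (cox_pow (MB n) ⟨0, cox_zero_lt n hn⟩ j 2 (by rw [MB_apply]; dsimp only; split_ifs <;> omega))
        have h := cox_pow (MB n) ⟨1, cox_one_lt n hn⟩ j _ rfl
        rw [e]
        have h0' := inv_eq_of_mul_eq_one_left h0
        rw [mul_assoc, c]
        have : ∀ a b x : (MB n).Group, a * b * (x * a) = a * (b * x) * a := by intros; group
        rw [this]
        nth_rw 2 [← h0']
        rw [conj_pow, h]; group
    · simp only [hi, if_false]
      exact cox_pow _ _ _ _ (by rw [MB_apply, MD_apply]; split_ifs <;> omega)

theorem exists_sigma (n : ℕ) (hn : 2 ≤ n) : ∃ σ : MulAut (MD n).Group, σ * σ = 1 ∧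
    ∀ i, σ ((MD n).simple i) =
      (MD n).simple (Equiv.swap (⟨0, cox_zero_lt n hn⟩ : Fin n) ⟨1, cox_one_lt n hn⟩ i) := by
  obtain ⟨φ, hφ⟩ := cox_lift (MD n)
    (fun i => (MD n).simple (Equiv.swap (⟨0, cox_zero_lt n hn⟩ : Fin n) ⟨1, cox_one_lt n hn⟩ i))
    (fun i => cox_sq _ _) (by
      intro i j hij
      refine cox_pow _ _ _ _ ?_
      have hij' : (i : ℕ) < j := hij
      simp only [MD_apply, Equiv.swap_apply_def, Fin.ext_iff, apply_ite Fin.val]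
      grind)
  have hh : φ.comp φ = MonoidHom.id _ := by
    apply cox_ext
    intro i
    simp [hφ]
  refine ⟨MonoidHom.toMulEquiv φ φ hh hh, ?_, hφ⟩
  ext x
  exact DFunLike.congr_fun hh x

theorem exists_p (n : ℕ) :
    ∃ p : (MB n).Group →* ℤˣ, ∀ i, p ((MB n).simple i) = if (i : ℕ) = 0 then -1 else 1 := by
  refine cox_lift (MB n) _ ?_ ?_
  · intro i; split_ifs <;> simp
  · intro i j hij
    have hij' : (i : ℕ) < j := hij
    have hj : (j : ℕ) ≠ 0 := by omega
    simp only [hj, if_false]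
    rw [MB_apply]
    split_ifs <;> first | omega | (simp; done) | (simp; decide)

theorem exists_k (n : ℕ) (hn : 2 ≤ n) (σ : MulAut (MD n).Group) (hs : σ * σ = 1)
    (hσ : ∀ i, σ ((MD n).simple i) =
      (MD n).simple (Equiv.swap (⟨0, cox_zero_lt n hn⟩ : Fin n) ⟨1, cox_one_lt n hn⟩ i)) :
    ∃ k : (MB n).Group →* (MD n).Group ⋊[MonoidHom.id (MulAut (MD n).Group)] MulAut (MD n).Group,
      ∀ i, k ((MB n).simple i) = if (i : ℕ) = 0 then SemidirectProduct.inr σ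
        else SemidirectProduct.inl ((MD n).simple i) := by
  refine cox_lift (MB n) _ ?_ ?_
  · intro i
    split_ifs
    · rw [← map_mul, hs, map_one]
    · rw [← map_mul, cox_sq, map_one]
  · intro i j hij
    have hij' : (i : ℕ) < j := hij
    have hj : (j : ℕ) ≠ 0 := by omega
    simp only [hj, if_false]
    by_cases hi : (i : ℕ) = 0
    · simp only [hi, if_true]
      have key : ((SemidirectProduct.inr σ * SemidirectProduct.inl ((MD n).simple j) :
          (MD n).Group ⋊[MonoidHom.id (MulAut (MD n).Group)] MulAut (MD n).Group)) ^ 2 =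
          SemidirectProduct.inl (σ ((MD n).simple j) * (MD n).simple j) := by
        have hs' : ∀ x, σ (σ x) = x := fun x => DFunLike.congr_fun hs x
        rw [pow_two]
        ext
        · simp [hs']
        · simp [hs]
      by_cases hj1 : (j : ℕ) = 1
      · have e : MB n i j = 2 * 2 := by rw [MB_apply]; split_ifs <;> omega
        have hj' : j = ⟨1, cox_one_lt n hn⟩ := Fin.ext hj1
        rw [e, pow_mul, key, hσ, hj', Equiv.swap_apply_right, ← map_pow,
          cox_pow _ _ _ 2 (by simp [MD_apply]), map_one]
      · have e : MB n i j = 2 := by rw [MB_apply]; split_ifs <;> omega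
        rw [e, key, hσ, Equiv.swap_apply_of_ne_of_ne, cox_sq, map_one]
        · simpa [Fin.ext_iff] using hj
        · simpa [Fin.ext_iff] using hj1
    · simp only [hi, if_false]
      rw [← map_mul, ← map_pow, cox_pow _ _ _ _ _, map_one]
      rw [MB_apply, MD_apply]; split_ifs <;> omega

end CoxAux

/-- there is an injective homomorphism `j : W(Dₙ) → W(Bₙ)` with
`j(t₀) = s₀ s₁ s₀` and `j(tᵢ) = sᵢ` for `1 ≤ i ≤ n - 1`, whose image is normal of index 2. -/
theorem coxeterD_embeds_in_coxeterB (n : ℕ) (hn : 2 ≤ n) :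
    ∃ j : (MD n).Group →* (MB n).Group,
      (j ((MD n).simple ⟨0, by omega⟩) =
        (MB n).simple ⟨0, by omega⟩ * (MB n).simple ⟨1, by omega⟩ *
          (MB n).simple ⟨0, by omega⟩) ∧
      (∀ (i : ℕ) (_h1 : 1 ≤ i) (h2 : i < n),
        j ((MD n).simple ⟨i, h2⟩) = (MB n).simple ⟨i, h2⟩) ∧
      Function.Injective j ∧
      j.range.Normal ∧
      j.range.index = 2 := by
  obtain ⟨j, hj⟩ := exists_j n hn
  obtain ⟨σ, hs, hσ⟩ := exists_sigma n hn
  obtain ⟨p, hp⟩ := exists_p n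
  obtain ⟨k, hk⟩ := exists_k n hn σ hs hσ
  have h0 := cox_sq (MB n) ⟨0, by omega⟩
  have hj0 : j ((MD n).simple ⟨0, by omega⟩) = (MB n).simple ⟨0, by omega⟩ *
      (MB n).simple ⟨1, by omega⟩ * (MB n).simple ⟨0, by omega⟩ := by rw [hj]; simp
  have hj1 : ∀ (i : ℕ) (_h1 : 1 ≤ i) (h2 : i < n),
      j ((MD n).simple ⟨i, h2⟩) = (MB n).simple ⟨i, h2⟩ := by
    intro i h1 h2
    rw [hj, if_neg]
    dsimp only; omega
  have hinj : Function.Injective j := by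
    have : k.comp j = SemidirectProduct.inl := by
      apply cox_ext
      intro i
      by_cases hi : (i : ℕ) = 0
      · have hi' : i = ⟨0, by omega⟩ := Fin.ext hi
        rw [hi', MonoidHom.comp_apply, hj0, map_mul, map_mul, hk, hk]
        simp only [one_ne_zero, if_true, if_false]
        have h2 := SemidirectProduct.inl_aut (φ := MonoidHom.id (MulAut (MD n).Group)) σ
          ((MD n).simple ⟨1, by omega⟩)
        rw [inv_eq_of_mul_eq_one_left hs] at h2
        rw [← h2, MonoidHom.id_apply, hσ, Equiv.swap_apply_right]
      · rw [MonoidHom.comp_apply, hj, if_neg hi, hk, if_neg hi]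
    intro x y hxy
    apply SemidirectProduct.inl_injective (φ := MonoidHom.id (MulAut (MD n).Group))
    rw [← this, MonoidHom.comp_apply, hxy, MonoidHom.comp_apply]
  have hpj : ∀ x ∈ j.range, p x = 1 := by
    have : p.comp j = 1 := by
      apply cox_ext
      intro i
      rw [MonoidHom.comp_apply, hj]
      split_ifs with h
      · rw [map_mul, map_mul, hp, hp]; simp
      · rw [hp, if_neg h]; rfl
    rintro _ ⟨y, rfl⟩
    exact DFunLike.congr_fun this y
  have hcov : ∀ w : (MB n).Group,
      w ∈ j.range ∨ (MB n).simple ⟨0, by omega⟩ * w ∈ j.range := by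
    intro w
    induction w using (MB n).toCoxeterSystem.simple_induction_left with
    | one => exact Or.inl (one_mem _)
    | mul_simple_left w i ih =>
      rw [CoxeterMatrix.toCoxeterSystem_simple]
      by_cases hi : (i : ℕ) = 0
      · have hi' : i = ⟨0, by omega⟩ := Fin.ext hi
        rw [hi', ← mul_assoc, h0, one_mul]
        exact ih.symm
      · have hm : (MB n).simple i ∈ j.range := ⟨(MD n).simple i, by rw [hj, if_neg hi]⟩
        rcases ih with ih | ih
        · exact Or.inl (mul_mem hm ih)
        · right
          have hc : (MB n).simple ⟨0, by omega⟩ * (MB n).simple i * (MB n).simple ⟨0, by omega⟩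
              ∈ j.range := by
            by_cases hi1 : (i : ℕ) = 1
            · have hi' : i = ⟨1, by omega⟩ := Fin.ext hi1
              rw [hi']
              exact ⟨_, hj0⟩
            · have c := cox_comm h0 (cox_sq (MB n) i)
                (cox_pow (MB n) ⟨0, by omega⟩ i 2
                  (by rw [MB_apply]; dsimp only; split_ifs <;> omega))
              rw [c, mul_assoc, h0, mul_one]
              exact hm
          have := mul_mem hc ih
          rwa [show ∀ a b w : (MB n).Group, a * b * a * (a * w) = a * b * (a * a) * w by
            intros; group, h0, mul_one, mul_assoc] at this
  have hidx : j.range.index = 2 := by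
    rw [Subgroup.index_eq_two_iff']
    refine ⟨(MB n).simple ⟨0, by omega⟩, fun b => ?_⟩
    have hx : ¬ (((MB n).simple ⟨0, by omega⟩ * b ∈ j.range) ∧ b ∈ j.range) := by
      rintro ⟨h1, h2⟩
      have h1 := hpj _ h1
      rw [map_mul, hpj _ h2, hp] at h1
      simp at h1
    have := hcov b
    rw [xor_iff_or_and_not_and]
    tauto
  exact ⟨j, hj0, hj1, hinj, Subgroup.normal_of_index_eq_two hidx, hidx⟩
end

section
/- Let n ≥ 1. There exists a group isomorphism e : W(Bₙ) ≃* Bₙ such that e(s₀ᵂ) = s₀ and e(sᵢᵂ) = tᵢ for all 1 ≤ i ≤ n − 1, where s₀ is the sign change in the first coordinate and tᵢ is the signed permutation exchanging coordinates i − 1 and i. (The Coxeter group of type Bₙ is the group of signed permutations on n letters.) -/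
section orbit

variable {G X : Type*} [Group G] [MulAction G X]

structure BRel (s : ℕ → G) (n : ℕ) : Prop where
  sq : ∀ i, i < n → s i * s i = 1
  comm : ∀ i j, i + 1 < j → j < n → s i * s j = s j * s i
  braid : ∀ i, 1 ≤ i → i + 1 < n → s i * s (i+1) * s i = s (i+1) * s i * s (i+1)
  braid4 : 1 < n → s 0 * s 1 * s 0 * s 1 = s 1 * s 0 * s 1 * s 0

theorem BRel.comm' {s : ℕ → G} {n : ℕ} (h : BRel s n) (i j : ℕ) (hi : i < n) (hj : j < n)
    (hij : i + 1 < j ∨ j + 1 < i) : s i * s j = s j * s i := by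
  rcases hij with h1 | h1
  · exact h.comm i j h1 hj
  · exact (h.comm j i h1 hi).symm

theorem orbit_a {s : ℕ → G} {n m : ℕ} (h : BRel s n) (hm : m < n) (a : ℕ → X)
    (hbase : ∀ i, i < m → s i • a m = a m)
    (ha : ∀ j, j < m → a j = s (j+1) • a (j+1)) :
    ∀ d j, m = j + d → ∀ i, i ≤ m → i ≠ j → i ≠ j + 1 → s i • a j = a j := by
  intro d
  induction d using Nat.strong_induction_on with
  | _ d ih =>
  intro j hj i hi h1 h2
  rcases Nat.eq_zero_or_pos d with hd | hd
  · have : j = m := by omega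
    subst this
    exact hbase i (by omega)
  · by_cases h3 : i = j + 2
    · subst h3
      have e1 := ha j (by omega)
      have e2 := ha (j+1) (by omega)
      have e3 := ih (d-2) (by omega) (j+2) (by omega) (j+1) (by omega) (by omega) (by omega)
      have br := h.braid (j+1) (by omega) (by omega)
      rw [e1, e2, ← mul_smul, ← mul_smul, ← br, mul_smul, e3, ← mul_smul]
    · have e1 := ha j (by omega)
      have e3 := ih (d-1) (by omega) (j+1) (by omega) i hi (by omega) (by omega)
      have := h.comm' i (j+1) (by omega) (by omega) (by omega)
      rw [e1, ← mul_smul, this, mul_smul, e3]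

theorem orbit_b {s : ℕ → G} {n m : ℕ} (h : BRel s n) (hm : m < n) (a b : ℕ → X)
    (hbase : ∀ i, i < m → s i • a m = a m)
    (ha : ∀ j, j < m → a j = s (j+1) • a (j+1))
    (hb0 : b 0 = s 0 • a 0)
    (hb : ∀ j, j < m → b (j+1) = s (j+1) • b j) :
    ∀ j, j ≤ m → ∀ i, i ≤ m → i ≠ j → i ≠ j + 1 → s i • b j = b j := by
  have hA := orbit_a h hm a hbase ha
  intro j
  induction j using Nat.strong_induction_on with
  | _ j ih =>
  intro hj i hi h1 h2
  rcases j with _ | j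
  · have := h.comm' i 0 (by omega) (by omega) (by omega)
    rw [hb0, ← mul_smul, this, mul_smul, hA m 0 (by omega) i hi h1 h2]
  · by_cases h3 : i = j
    · subst h3
      rcases i with _ | i
      · have e := hA (m-1) 1 (by omega) 0 (by omega) (by omega) (by omega)
        have br := h.braid4 (by omega)
        have e1 := ha 0 (by omega)
        have e2 := hb 0 (by omega)
        simp only [zero_add] at e1 e2 ⊢
        rw [e2, hb0, e1, ← mul_smul, ← mul_smul, ← mul_smul, br, mul_smul, e, ← mul_smul, ← mul_smul, mul_assoc]
      · have e := ih i (by omega) (by omega) (i+2) (by omega) (by omega) (by omega)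
        have br := h.braid (i+1) (by omega) (by omega)
        rw [hb (i+1) (by omega), hb i (by omega), ← mul_smul, ← mul_smul, br,
          mul_smul, e, ← mul_smul]
    · have e := ih j (by omega) (by omega) i (by omega) (by omega) (by omega)
      have := h.comm' i (j+1) (by omega) (by omega) (by omega)
      rw [hb j (by omega), ← mul_smul, this, mul_smul, e]

/-- index action -/
def actN (i : ℕ) (p : ℕ × ZMod 2) : ℕ × ZMod 2 :=
  if i = 0 then (p.1, if p.1 = 0 then p.2 + 1 else p.2)
  else (if p.1 = i then i - 1 else if p.1 + 1 = i then i else p.1, p.2)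

theorem zmod2_cases (e : ZMod 2) : e = 0 ∨ e = 1 := by
  revert e; decide

theorem orbit_exists {s : ℕ → G} {n m : ℕ} (h : BRel s n) (hm : m < n) (x0 : X)
    (hbase : ∀ i, i < m → s i • x0 = x0) :
    ∃ x : ℕ × ZMod 2 → X, x (m, 0) = x0 ∧
      ∀ i, i ≤ m → ∀ p, p.1 ≤ m → s i • x p = x (actN i p) := by
  let A : ℕ → X := fun d => Nat.rec x0 (fun d y => s (m - d) • y) d
  let a : ℕ → X := fun j => A (m - j)
  let b : ℕ → X := fun j => Nat.rec (s 0 • a 0) (fun j y => s (j+1) • y) j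
  have ham : a m = x0 := by simp [a, A]
  have ha : ∀ j, j < m → a j = s (j+1) • a (j+1) := by
    intro j hj
    obtain ⟨d, rfl⟩ : ∃ d, m = j + 1 + d := ⟨m - (j+1), by omega⟩
    have e1 : j + 1 + d - j = d + 1 := by omega
    have e2 : j + 1 + d - (j+1) = d := by omega
    have e3 : j + 1 + d - d = j + 1 := by omega
    simp only [a, e1, e2]
    change s (j + 1 + d - d) • A d = _
    rw [e3]
  have hb0 : b 0 = s 0 • a 0 := rfl
  have hb : ∀ j, j < m → b (j+1) = s (j+1) • b j := fun j _ => rfl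
  have hbase' : ∀ i, i < m → s i • a m = a m := by rw [ham]; exact hbase
  have hA := orbit_a h hm a hbase' ha
  have hB := orbit_b h hm a b hbase' ha hb0 hb
  have hs : ∀ i, i ≤ m → ∀ y : X, s i • s i • y = y := by
    intro i hi y
    rw [← mul_smul, h.sq i (by omega), one_smul]
  refine ⟨fun p => if p.2 = 0 then a p.1 else b p.1, by simp [ham], ?_⟩
  rintro i hi ⟨j, e⟩ hj
  simp only at hj
  rcases zmod2_cases e with rfl | rfl
  · rcases i with _ | i
    · rcases j with _ | j
      · simp [actN, hb0]
      · simp [actN, hA (m-(j+1)) (j+1) (by omega) 0 (by omega) (by omega) (by omega)]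
    · by_cases h1 : j = i + 1
      · subst h1
        simp [actN, ha i (by omega)]
      · by_cases h2 : j = i
        · subst h2
          simp [actN, ha j (by omega), hs (j+1) hi]
        · simp [actN, h1, h2, hA (m-j) j (by omega) (i+1) (by omega) (by omega) (by omega)]
  · rcases i with _ | i
    · rcases j with _ | j
      · have : (1 + 1 : ZMod 2) = 0 := by decide
        simp [actN, hb0, this, hs 0 hi]
      · simp [actN, hB (j+1) (by omega) 0 (by omega) (by omega) (by omega)]
    · by_cases h1 : j = i + 1
      · subst h1
        simp [actN, hb i (by omega), hs (i+1) hi]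
      · by_cases h2 : j = i
        · subst h2
          simp [actN, hb j (by omega)]
        · simp [actN, h1, h2, hB j (by omega) (i+1) (by omega) (by omega) (by omega)]

end orbit

/-- generators -/
def gB (n : ℕ) (hn : 1 ≤ n) (i : Fin n) : Equiv.Perm (Fin n × ZMod 2) :=
  if h : (i : ℕ) = 0 then sZero n hn else tGen n i (Nat.one_le_iff_ne_zero.mpr h) i.2

/-- forget bound -/
def toN {n : ℕ} (p : Fin n × ZMod 2) : ℕ × ZMod 2 := (p.1, p.2)

theorem toN_inj {n : ℕ} {p q : Fin n × ZMod 2} (h : toN p = toN q) : p = q := by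
  rcases p with ⟨⟨a, _⟩, e⟩
  rcases q with ⟨⟨b, _⟩, f⟩
  simp only [toN, Prod.mk.injEq] at h
  obtain ⟨rfl, rfl⟩ := h
  rfl

theorem gB_apply (n : ℕ) (hn : 1 ≤ n) (i : Fin n) (p : Fin n × ZMod 2) :
    toN (gB n hn i p) = actN i (toN p) := by
  rcases p with ⟨⟨j, hj⟩, e⟩
  rcases i with ⟨i, hi⟩
  have : (1 + 1 : ZMod 2) = 0 := by decide
  rcases i with _ | i
  · rcases zmod2_cases e with rfl | rfl <;> by_cases h : j = 0 <;>
      simp [gB, sZero, toN, actN, Equiv.swap_apply_def, h, this]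
  · rcases zmod2_cases e with rfl | rfl <;> by_cases h : j = i + 1 <;> by_cases h' : j = i <;>
      simp [gB, tGen, toN, actN, Equiv.swap_apply_def, h, h']

theorem gB_mem (n : ℕ) (hn : 1 ≤ n) (i : Fin n) : gB n hn i ∈ hyperB n := by
  rw [hyperB, Subgroup.mem_centralizer_singleton_iff]
  ext1 p
  apply toN_inj
  have hν : ∀ p : Fin n × ZMod 2, toN (negPerm n p) = ((toN p).1, (toN p).2 + 1) := fun p => rfl
  simp only [Equiv.Perm.mul_apply, gB_apply, hν, actN]
  split_ifs <;> rfl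

theorem actN_sq (i : ℕ) (p) : actN i (actN i p) = p := by
  rcases p with ⟨j, e⟩
  have : e + 1 + 1 = e := by revert e; decide
  simp only [actN]
  split_ifs <;> simp_all <;> omega

theorem actN_comm (i j : ℕ) (h : i + 1 < j) (p) : actN i (actN j p) = actN j (actN i p) := by
  rcases p with ⟨k, e⟩
  simp only [actN]
  split_ifs <;> simp_all <;> omega

theorem actN_braid (i : ℕ) (h : 1 ≤ i) (p) :
    actN i (actN (i+1) (actN i p)) = actN (i+1) (actN i (actN (i+1) p)) := by
  rcases p with ⟨k, e⟩
  obtain ⟨i, rfl⟩ : ∃ j, i = j + 1 := ⟨i - 1, by omega⟩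
  have q1 : ¬ (i = i + 1 + 1) := by omega
  have q2 : ¬ (i + 1 + 1 = i) := by omega
  by_cases h1 : k = i
  · simp [actN, h1, q1, q2]
  by_cases h2 : k = i + 1
  · simp [actN, h2, q1, q2]
  by_cases h3 : k = i + 2
  · simp [actN, h3, q1, q2]
  simp [actN, h1, h2, h3]

theorem actN_braid4 (p) :
    actN 0 (actN 1 (actN 0 (actN 1 p))) = actN 1 (actN 0 (actN 1 (actN 0 p))) := by
  rcases p with ⟨k, e⟩
  by_cases h1 : k = 0
  · simp [actN, h1]
  by_cases h2 : k = 1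
  · simp [actN, h2]
  simp [actN, h1, h2]

theorem gB_liftable (n : ℕ) (hn : 1 ≤ n) : 
    (MB n).IsLiftable (fun i => (⟨gB n hn i, gB_mem n hn i⟩ : hyperB n)) := by
  intro i j
  apply Subtype.ext
  rw [MB_apply]
  ext1 p
  apply toN_inj
  split_ifs with h1 h2 h3 <;>
    simp only [pow_succ, pow_zero, one_mul, Subgroup.coe_mul, Equiv.Perm.mul_apply, gB_apply,
      Subgroup.coe_one, Equiv.Perm.one_apply]
  · rw [h1, actN_sq]
  · rcases h2 with ⟨h, h'⟩ | ⟨h, h'⟩ <;> rw [h, h']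
    · rw [actN_braid4]
      simp only [actN_sq]
    · rw [← actN_braid4]
      simp only [actN_sq]
  · rcases h3 with ⟨⟨h, h'⟩, h3 | h3⟩ <;> rw [← h3]
    · rw [actN_braid _ h]; simp only [actN_sq]
    · rw [← actN_braid _ h']; simp only [actN_sq]
  · have : (i:ℕ) + 1 < j ∨ (j:ℕ) + 1 < i := by omega
    rcases this with h | h
    · rw [actN_comm _ _ h]; simp only [actN_sq]
    · rw [← actN_comm _ _ h]; simp only [actN_sq]

/-- the homomorphism -/
noncomputable def phiB (n : ℕ) (hn : 1 ≤ n) : (MB n).Group →* hyperB n :=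
  (MB n).toCoxeterSystem.lift ⟨_, gB_liftable n hn⟩

theorem phiB_simple (n : ℕ) (hn : 1 ≤ n) (i : Fin n) :
    ((phiB n hn ((MB n).simple i) : hyperB n) : Equiv.Perm (Fin n × ZMod 2)) = gB n hn i := by
  have := (MB n).toCoxeterSystem.lift_apply_simple (gB_liftable n hn) i
  rw [CoxeterMatrix.toCoxeterSystem_simple] at this
  rw [phiB, this]

/-- nat-indexed generators -/
def sN (n : ℕ) (i : ℕ) : (MB n).Group := if h : i < n then (MB n).simple ⟨i, h⟩ else 1

theorem sN_rel (n : ℕ) (i j : Fin n) : (sN n i * sN n j) ^ (MB n i j) = 1 := by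
  have := (MB n).toCoxeterSystem.simple_mul_simple_pow i j
  rw [CoxeterMatrix.toCoxeterSystem_simple] at this
  simpa [sN] using this

theorem sN_brel (n : ℕ) : BRel (sN n) n := by
  have sq : ∀ i, i < n → sN n i * sN n i = 1 := by
    intro i hi
    have := sN_rel n ⟨i, hi⟩ ⟨i, hi⟩
    simpa [MB_apply] using this
  have inv : ∀ i, i < n → (sN n i)⁻¹ = sN n i := fun i hi => inv_eq_of_mul_eq_one_left (sq i hi)
  refine ⟨sq, ?_, ?_, ?_⟩
  · intro i j hij hj
    have := sN_rel n ⟨i, by omega⟩ ⟨j, hj⟩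
    rw [MB_apply] at this
    simp only at this
    rw [if_neg (by omega), if_neg (by omega), if_neg (by omega), pow_two,
      mul_eq_one_iff_eq_inv, mul_inv_rev, inv i (by omega), inv j hj] at this
    exact this
  · intro i hi hj
    have := sN_rel n ⟨i, by omega⟩ ⟨i+1, hj⟩
    rw [MB_apply] at this
    simp only at this
    rw [if_neg (by omega), if_neg (by omega), if_pos (by simp [hi])] at this
    have h2 : (sN n i * sN n (i+1) * sN n i) * (sN n (i+1) * sN n i * sN n (i+1)) = 1 := by
      rw [← this]; simp only [pow_succ, pow_zero, one_mul, mul_assoc]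
    rw [mul_eq_one_iff_eq_inv] at h2
    simp only [mul_inv_rev, inv i (by omega), inv (i+1) hj] at h2
    rw [h2, mul_assoc]
  · intro hj
    have := sN_rel n ⟨0, by omega⟩ ⟨1, hj⟩
    rw [MB_apply] at this
    simp only at this
    rw [if_neg (by omega), if_pos (by simp)] at this
    have h2 : (sN n 0 * sN n 1 * sN n 0 * sN n 1) * (sN n 0 * sN n 1 * sN n 0 * sN n 1) = 1 := by
      rw [← this]; simp only [pow_succ, pow_zero, one_mul, mul_assoc]
    rw [mul_eq_one_iff_eq_inv] at h2
    simp only [mul_inv_rev, inv 0 (by omega), inv 1 hj] at h2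
    rw [h2]; simp only [mul_assoc]

/-- parabolic subgroup -/
def parB (n k : ℕ) : Subgroup (MB n).Group := Subgroup.closure {w | ∃ i, i < k ∧ w = sN n i}

theorem sN_mem (n k i : ℕ) (h : i < k) : sN n i ∈ parB n k := Subgroup.subset_closure ⟨i, h, rfl⟩

theorem parB_top (n : ℕ) (w : (MB n).Group) : w ∈ parB n n := by
  refine (MB n).toCoxeterSystem.simple_induction w ?_ (one_mem _) (fun _ _ h h' => mul_mem h h')
  intro i
  rw [CoxeterMatrix.toCoxeterSystem_simple]
  have := sN_mem n n i i.2
  simpa [sN] using this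

theorem parB_mono (n : ℕ) {k l : ℕ} (h : k ≤ l) : parB n k ≤ parB n l :=
  Subgroup.closure_mono (by rintro w ⟨i, hi, rfl⟩; exact ⟨i, by omega, rfl⟩)

theorem phiB_sN (n : ℕ) (hn : 1 ≤ n) (i : ℕ) (hi : i < n) (p : Fin n × ZMod 2) :
    toN ((phiB n hn (sN n i) : Equiv.Perm (Fin n × ZMod 2)) p) = actN i (toN p) := by
  rw [sN, dif_pos hi, phiB_simple, gB_apply]

theorem actN_le (i m : ℕ) (hi : i ≤ m) (p : ℕ × ZMod 2) (hp : p.1 ≤ m) : (actN i p).1 ≤ m := by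
  simp only [actN]; split_ifs <;> simp <;> omega

theorem actN_fix (i : ℕ) (p : ℕ × ZMod 2) (hp : i < p.1) : actN i p = p := by
  rcases p with ⟨j, e⟩
  simp only at hp
  simp only [actN]
  split_ifs <;> simp <;> omega

theorem parB_ind (n k : ℕ) (hk : k ≤ n) (P : (MB n).Group → Prop) (h1 : P 1)
    (hs : ∀ i, i < k → ∀ w, P w → P (sN n i * w)) : ∀ w ∈ parB n k, P w := by
  intro w hw
  induction hw using Subgroup.closure_induction_left with
  | one => exact h1
  | mul_left x hx y _ ih =>
    obtain ⟨i, hi, rfl⟩ := hx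
    exact hs i hi y ih
  | inv_mul_cancel x hx y _ ih =>
    obtain ⟨i, hi, rfl⟩ := hx
    rw [inv_eq_of_mul_eq_one_left ((sN_brel n).sq i (by omega))]
    exact hs i hi y ih

theorem stab_mem (n : ℕ) (hn : 1 ≤ n) (m : ℕ) (hm : m < n) (w : (MB n).Group)
    (hw : w ∈ parB n (m+1))
    (hfix : (phiB n hn w : Equiv.Perm (Fin n × ZMod 2)) (⟨m, hm⟩, 0) = (⟨m, hm⟩, 0)) :
    w ∈ parB n m := by
  obtain ⟨x, hx0, hx⟩ := orbit_exists (X := (MB n).Group ⧸ parB n m) (sN_brel n) hm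
    (QuotientGroup.mk 1) (by
      intro i hi
      rw [MulAction.Quotient.smul_mk, eq_comm, QuotientGroup.eq]
      simpa using sN_mem n m i hi)
  have key : ∀ w ∈ parB n (m+1),
      (toN ((phiB n hn w : Equiv.Perm (Fin n × ZMod 2)) (⟨m, hm⟩, 0))).1 ≤ m ∧
      (QuotientGroup.mk w : (MB n).Group ⧸ parB n m) =
        x (toN ((phiB n hn w : Equiv.Perm (Fin n × ZMod 2)) (⟨m, hm⟩, 0))) := by
    apply parB_ind n (m+1) hm
    · simp [toN, hx0]
    · rintro i hi w ⟨h1, h2⟩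
      rw [map_mul, Subgroup.coe_mul, Equiv.Perm.mul_apply, phiB_sN n hn i (by omega)]
      refine ⟨actN_le _ _ (by omega) _ h1, ?_⟩
      rw [← hx i (by omega) _ h1, ← h2]
      rfl
  have := (key w hw).2
  rw [hfix] at this
  change _ = x (m, 0) at this
  rw [hx0, eq_comm, QuotientGroup.eq] at this
  simpa using this

theorem parB_zero (n : ℕ) (w : (MB n).Group) (hw : w ∈ parB n 0) : w = 1 := by
  simpa [parB] using hw

theorem phiB_inj (n : ℕ) (hn : 1 ≤ n) : Function.Injective (phiB n hn) := by
  rw [injective_iff_map_eq_one]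
  intro w hw
  have : ∀ k, k ≤ n → w ∈ parB n k → w = 1 := by
    intro k
    induction k with
    | zero => intro _ h; exact parB_zero n w h
    | succ k ih =>
      intro hk h
      exact ih (by omega) (stab_mem n hn k hk w h (by rw [hw]; rfl))
  exact this n le_rfl (parB_top n w)

theorem phiB_fix (n : ℕ) (hn : 1 ≤ n) (k : ℕ) (hk : k ≤ n) (w) (hw : w ∈ parB n k)
    (p : Fin n × ZMod 2) (hp : k ≤ p.1) : (phiB n hn w : Equiv.Perm (Fin n × ZMod 2)) p = p := by
  revert w
  apply parB_ind n k hk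
  · simp
  · intro i hi w h
    rw [map_mul, Subgroup.coe_mul, Equiv.Perm.mul_apply, h]
    apply toN_inj
    rw [phiB_sN n hn i (by omega)]
    apply actN_fix
    simp only [toN]; omega

theorem phiB_trans (n : ℕ) (hn : 1 ≤ n) (m : ℕ) (hm : m < n) (p : ℕ × ZMod 2) (hp : p.1 ≤ m) :
    ∃ w ∈ parB n (m+1),
      toN ((phiB n hn w : Equiv.Perm (Fin n × ZMod 2)) (⟨m, hm⟩, 0)) = p := by
  have step : ∀ p q : ℕ × ZMod 2, ∀ i, i ≤ m → actN i p = q → (∃ w ∈ parB n (m+1),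
      toN ((phiB n hn w : Equiv.Perm (Fin n × ZMod 2)) (⟨m, hm⟩, 0)) = p) →
      (∃ w ∈ parB n (m+1),
      toN ((phiB n hn w : Equiv.Perm (Fin n × ZMod 2)) (⟨m, hm⟩, 0)) = q) := by
    rintro p q i hi rfl ⟨w, hw, rfl⟩
    refine ⟨sN n i * w, mul_mem (sN_mem n _ i (by omega)) hw, ?_⟩
    rw [map_mul, Subgroup.coe_mul, Equiv.Perm.mul_apply, phiB_sN n hn i (by omega)]
  have ha : ∀ d j, m = j + d → ∃ w ∈ parB n (m+1),
      toN ((phiB n hn w : Equiv.Perm (Fin n × ZMod 2)) (⟨m, hm⟩, 0)) = (j, 0) := by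
    intro d
    induction d with
    | zero => rintro j rfl; exact ⟨1, one_mem _, rfl⟩
    | succ d ih =>
      intro j hj
      exact step _ _ (j+1) (by omega) (by simp [actN]) (ih (j+1) (by omega))
  have hb : ∀ j, j ≤ m → ∃ w ∈ parB n (m+1),
      toN ((phiB n hn w : Equiv.Perm (Fin n × ZMod 2)) (⟨m, hm⟩, 0)) = (j, 1) := by
    intro j
    induction j with
    | zero => intro _; exact step _ _ 0 (by omega) (by simp [actN]) (ha m 0 (by omega))
    | succ j ih =>
      intro hj
      exact step _ _ (j+1) (by omega) (by simp [actN]) (ih (by omega))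
  rcases p with ⟨j, e⟩
  simp only at hp
  rcases zmod2_cases e with rfl | rfl
  · exact ha (m - j) j (by omega)
  · exact hb j hp

theorem phiB_surj (n : ℕ) (hn : 1 ≤ n) : Function.Surjective (phiB n hn) := by
  have : ∀ k, k ≤ n → ∀ g : hyperB n, (∀ p : Fin n × ZMod 2, k ≤ p.1 → g.1 p = p) →
      ∃ w, phiB n hn w = g := by
    intro k
    induction k with
    | zero =>
      intro _ g hg
      refine ⟨1, ?_⟩
      rw [map_one]
      apply Subtype.ext
      ext1 p
      exact (hg p (Nat.zero_le _)).symm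
    | succ m ih =>
      intro hm g hg
      have hle : (toN (g.1 (⟨m, hm⟩, 0))).1 ≤ m := by
        by_contra hc
        have h1 := hg (g.1 (⟨m, hm⟩, 0)) (by simp only [toN] at hc; omega)
        have h2 := g.1.injective h1
        rw [h2] at hc
        exact hc le_rfl
      obtain ⟨c, hc, hcp⟩ := phiB_trans n hn m hm _ hle
      have hcp := toN_inj hcp
      obtain ⟨w, hw⟩ := ih (by omega) ((phiB n hn c)⁻¹ * g) (by
        intro p hp
        rw [Subgroup.coe_mul, Subgroup.coe_inv, Equiv.Perm.mul_apply, Equiv.Perm.inv_eq_iff_eq]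
        by_cases hpm : m + 1 ≤ p.1
        · rw [hg p hpm, phiB_fix n hn (m+1) hm c hc p hpm]
        · have hν : ∀ h : hyperB n, ∀ q, h.1 (negPerm n q) = negPerm n (h.1 q) := by
            intro h q
            have : h.1 ∈ Subgroup.centralizer {negPerm n} := h.2
            rw [Subgroup.mem_centralizer_singleton_iff] at this
            exact (DFunLike.congr_fun this q)
          rcases p with ⟨⟨j, hj⟩, e⟩
          simp only at hp hpm
          obtain rfl : j = m := by omega
          rcases zmod2_cases e with rfl | rfl
          · exact hcp.symm
          · have : ((⟨j, hj⟩, 1) : Fin n × ZMod 2) = negPerm n (⟨j, hj⟩, 0) := by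
              simp [negPerm]
            rw [this, hν, hν, hcp])
      exact ⟨c * w, by rw [map_mul, hw, mul_inv_cancel_left]⟩
  intro g
  exact this n le_rfl g (fun p hp => absurd p.1.2 (by omega))

/-- the Coxeter group of type `Bₙ` is isomorphic to the hyperoctahedral group of
signed permutations, via `s₀ᵂ ↦ s₀` and `sᵢᵂ ↦ tᵢ`. -/
theorem coxeterB_iso_hyperB (n : ℕ) (hn : 1 ≤ n) :
    ∃ e : (MB n).Group ≃* hyperB n,
      ((e ((MB n).simple ⟨0, hn⟩) : hyperB n) : Equiv.Perm (Fin n × ZMod 2)) = sZero n hn ∧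
      ∀ (i : ℕ) (h1 : 1 ≤ i) (h2 : i < n),
        ((e ((MB n).simple ⟨i, h2⟩) : hyperB n) : Equiv.Perm (Fin n × ZMod 2))
          = tGen n i h1 h2 := by
  refine ⟨MulEquiv.ofBijective (phiB n hn) ⟨phiB_inj n hn, phiB_surj n hn⟩, ?_, ?_⟩
  · refine (phiB_simple n hn _).trans ?_
    simp [gB]
  · intro i h1 h2
    refine (phiB_simple n hn _).trans ?_
    simp [gB, show i ≠ 0 by omega]
end

section
/- Let n ≥ 2. There exists a group isomorphism e : W(Dₙ) ≃* Dₙ' such that e(t₀ᵂ) = t₀ and e(tᵢᵂ) = tᵢ for all 1 ≤ i ≤ n − 1. (The Coxeter group of type Dₙ is the group of even signed permutations: the image of j_n : Dₙ → Bₙ is Bₙ ∩ Alt(2n).) -/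
def AdjD (i j : ℕ) : Prop := (i = 0 ∧ j = 2) ∨ (1 ≤ i ∧ j = i + 1)

theorem abs_p {X : Type*} (s : ℕ → X → X) (m : ℕ) (p : ℕ → X)
    (comm : ∀ i j, i < j → j ≤ m → ¬ AdjD i j → ∀ x, s i (s j x) = s j (s i x))
    (braid : ∀ i j, AdjD i j → j ≤ m → ∀ x, s i (s j (s i x)) = s j (s i (s j x)))
    (hp : ∀ j, j < m → p j = s (j + 1) (p (j + 1)))
    (h1 : ∀ i, i < m → 2 ≤ m → s i (p m) = p m) :
    ∀ k j, j + k = m → ∀ i, i ≤ m → i ≠ j → i ≠ j + 1 → (i = 0 → 2 ≤ j) → s i (p j) = p j := by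
  intro k
  induction k using Nat.strong_induction_on with
  | _ k ih =>
    intro j hj i hi hij hij1 h0
    rcases Nat.eq_zero_or_pos k with hk | hk
    · have : j = m := by omega
      subst this
      exact h1 i (by omega) (by omega)
    · by_cases hi2 : i = j + 2
      · subst hi2
        rw [hp j (by omega), hp (j+1) (by omega),
          ← braid (j+1) (j+2) (Or.inr ⟨by omega, rfl⟩) hi,
          ih (k-2) (by omega) (j+2) (by omega) (j+1) (by omega) (by omega) (by omega) (by omega)]
      · have e := ih (k-1) (by omega) (j+1) (by omega) i hi (by omega) (by omega) (by omega)
        rw [hp j (by omega)]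
        rcases lt_or_gt_of_ne hij1 with h | h
        · rw [comm i (j+1) h (by omega) (by unfold AdjD; omega), e]
        · rw [← comm (j+1) i h (by omega) (by unfold AdjD; omega), e]

theorem abs_q {X : Type*} (s : ℕ → X → X) (m : ℕ) (hm : 1 ≤ m) (p q : ℕ → X)
    (comm : ∀ i j, i < j → j ≤ m → ¬ AdjD i j → ∀ x, s i (s j x) = s j (s i x))
    (braid : ∀ i j, AdjD i j → j ≤ m → ∀ x, s i (s j (s i x)) = s j (s i (s j x)))
    (hp : ∀ j, j < m → p j = s (j + 1) (p (j + 1)))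
    (h1 : ∀ i, i < m → 2 ≤ m → s i (p m) = p m)
    (hq0 : q 0 = s 0 (p 1)) (hq : ∀ j, q (j + 1) = s (j + 1) (q j)) :
    ∀ j, j ≤ m → ∀ i, i ≤ m → i ≠ j → i ≠ j + 1 → (i = 0 → 2 ≤ j) → s i (q j) = q j := by
  have A := abs_p s m p comm braid hp h1
  have hq1 : q 1 = s 0 (p 0) := by
    rw [hq, hq0, hp 0 (by omega), comm 0 1 (by omega) hm (by unfold AdjD; omega)]
  intro j
  induction j using Nat.strong_induction_on with
  | _ j ih =>
    intro hj i hi hij hij1 h0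
    match j, ih, hj, hij, hij1, h0 with
    | 0, ih, hj, hij, hij1, h0 =>
      by_cases h2 : i = 2
      · subst h2
        rw [hq0, hp 1 (by omega), ← braid 0 2 (Or.inl ⟨rfl, rfl⟩) hi,
          A (m-2) 2 (by omega) 0 (by omega) (by omega) (by omega) (by omega)]
      · rw [hq0, ← comm 0 i (by omega) hi (by unfold AdjD; omega),
          A (m-1) 1 (by omega) i (by omega) (by omega) (by omega) (by omega)]
    | 1, ih, hj, hij, hij1, h0 =>
      rw [hq1, ← comm 0 i (by omega) hi (by unfold AdjD; omega),
          A m 0 (by omega) i (by omega) (by omega) (by omega) (by omega)]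
    | 2, ih, hj, hij, hij1, h0 =>
      by_cases hi0 : i = 0
      · subst hi0
        rw [hq, hq1, braid 0 2 (Or.inl ⟨rfl, rfl⟩) hj,
          A m 0 (by omega) 2 (by omega) (by omega) (by omega) (by omega)]
      · by_cases hi1 : i = 1
        · subst hi1
          rw [hq, hq, braid 1 2 (Or.inr ⟨by omega, rfl⟩) hj,
            ih 0 (by omega) (by omega) 2 (by omega) (by omega) (by omega) (by omega)]
        · rw [hq, ← comm 2 i (by omega) hi (by unfold AdjD; omega),
            ih 1 (by omega) (by omega) i (by omega) (by omega) (by omega) (by omega)]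
    | j + 3, ih, hj, hij, hij1, h0 =>
      by_cases hi1 : i = j + 2
      · subst hi1
        rw [hq, hq, braid (j+2) (j+3) (Or.inr ⟨by omega, rfl⟩) hj,
            ih (j+1) (by omega) (by omega) (j+3) (by omega) (by omega) (by omega) (by omega)]
      · have e := ih (j+2) (by omega) (by omega) i (by omega) (by omega) (by omega) (by omega)
        rw [hq]
        rcases lt_or_gt_of_ne hij with h | h
        · rw [comm i (j+2+1) h (by omega) (by unfold AdjD; omega), e]
        · rw [← comm (j+2+1) i h (by omega) (by unfold AdjD; omega), e]

theorem abs_act {X : Type*} (s : ℕ → X → X) (m : ℕ) (hm : 1 ≤ m) (x0 : X)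
    (sq : ∀ i, i ≤ m → ∀ x, s i (s i x) = x)
    (comm : ∀ i j, i < j → j ≤ m → ¬ AdjD i j → ∀ x, s i (s j x) = s j (s i x))
    (braid : ∀ i j, AdjD i j → j ≤ m → ∀ x, s i (s j (s i x)) = s j (s i (s j x)))
    (h1 : ∀ i, i < m → 2 ≤ m → s i x0 = x0) :
    ∃ p : ℕ → ZMod 2 → X, p m 0 = x0 ∧
      (∀ e, s 0 (p 0 e) = p 1 (e + 1)) ∧ (∀ e, s 0 (p 1 e) = p 0 (e + 1)) ∧
      (∀ j e, 2 ≤ j → j ≤ m → s 0 (p j e) = p j e) ∧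
      (∀ i j e, 1 ≤ i → i ≤ m → j ≤ m →
        s i (p j e) = p (if j = i - 1 then i else if j = i then i - 1 else j) e) := by
  let P : ℕ → X := fun k => Nat.rec x0 (fun k y => s (m - k) y) k
  let p : ℕ → X := fun j => P (m - j)
  have hp : ∀ j, j < m → p j = s (j + 1) (p (j + 1)) := by
    intro j hj
    obtain ⟨k, rfl⟩ : ∃ k, m = j + 1 + k := ⟨m - (j+1), by omega⟩
    have e1 : j + 1 + k - j = k + 1 := by omega
    have e2 : j + 1 + k - (j + 1) = k := by omega
    have e3 : j + 1 + k - k = j + 1 := by omega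
    change P _ = s _ (P _)
    rw [e1, e2]
    change s (j + 1 + k - k) (P k) = _
    rw [e3]
  have hpm : p m = x0 := by
    change P (m - m) = x0
    rw [Nat.sub_self]
    exact rfl
  let q : ℕ → X := fun k => Nat.rec (s 0 (p 1)) (fun k y => s (k+1) y) k
  have hq0 : q 0 = s 0 (p 1) := rfl
  have hq : ∀ j, q (j + 1) = s (j + 1) (q j) := fun j => rfl
  clear_value p q
  have h1' : ∀ i, i < m → 2 ≤ m → s i (p m) = p m := by rw [hpm]; exact h1
  have A := abs_p s m p comm braid hp h1'
  have B := abs_q s m hm p q comm braid hp h1' hq0 hq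
  have hq1 : q 1 = s 0 (p 0) := by
    rw [hq, hq0, hp 0 (by omega), comm 0 1 (by omega) hm (by unfold AdjD; omega)]
  have dich : ∀ e : ZMod 2, e = 0 ∨ e = 1 := by decide
  have z1 : (1 : ZMod 2) ≠ 0 := by decide
  have z2 : (1 : ZMod 2) + 1 = 0 := by decide
  refine ⟨fun j e => if e = 0 then p j else q j, by simp [hpm], ?_, ?_, ?_, ?_⟩
  · intro e; rcases dich e with rfl | rfl
    · simp [hq1]
    · simp [z2, hq0, sq]
  · intro e; rcases dich e with rfl | rfl
    · simp [hq0]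
    · simp [z2, hq1, sq]
  · intro j e h2 hj; rcases dich e with rfl | rfl
    · simpa using A (m-j) j (by omega) 0 (by omega) (by omega) (by omega) (by omega)
    · simpa using B j (by omega) 0 (by omega) (by omega) (by omega) (by omega)
  · intro i j e hi him hjm
    obtain ⟨i, rfl⟩ : ∃ k, i = k + 1 := ⟨i - 1, by omega⟩
    have ee : i + 1 - 1 = i := rfl
    rw [ee]
    split_ifs with c1 c2
    · subst c1
      rcases dich e with rfl | rfl
      · simp [hp j (by omega), sq _ him]
      · simp [hq]
    · subst c2
      rcases dich e with rfl | rfl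
      · simp [hp i (by omega)]
      · simp [hq, sq _ him]
    · rcases dich e with rfl | rfl
      · simpa using A (m-j) j (by omega) (i+1) (by omega) (by omega) (by omega) (by omega)
      · simpa using B j (by omega) (i+1) (by omega) (by omega) (by omega) (by omega)

theorem tGen_apply (n i : ℕ) (h1 : 1 ≤ i) (h2 : i < n) (k : Fin n) (e : ZMod 2) :
    tGen n i h1 h2 (k, e) = (if (k : ℕ) = i - 1 then ⟨i, h2⟩ else
      if (k : ℕ) = i then ⟨i - 1, by omega⟩ else k, e) := by
  have dich : ∀ e : ZMod 2, e = 0 ∨ e = 1 := by decide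
  have z1 : (1 : ZMod 2) ≠ 0 := by decide
  unfold tGen
  simp only [Equiv.Perm.mul_apply, Equiv.swap_apply_def, Prod.ext_iff, Fin.ext_iff]
  rcases dich e with rfl | rfl <;> split_ifs <;> grind

theorem tZero_apply (n : ℕ) (hn : 2 ≤ n) (k : Fin n) (e : ZMod 2) :
    tZero n hn (k, e) = if (k : ℕ) = 0 then (⟨1, hn⟩, e + 1) else
      if (k : ℕ) = 1 then (⟨0, Nat.lt_of_lt_of_le Nat.zero_lt_two hn⟩, e + 1) else (k, e) := by
  have dich : ∀ e : ZMod 2, e = 0 ∨ e = 1 := by decide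
  have z1 : (1 : ZMod 2) ≠ 0 := by decide
  have z2 : (1 : ZMod 2) + 1 = 0 := by decide
  unfold tZero
  simp only [Equiv.Perm.mul_apply, Equiv.swap_apply_def, Prod.ext_iff, Fin.ext_iff]
  rcases dich e with rfl | rfl <;> split_ifs <;> grind

def TD (n : ℕ) (hn : 2 ≤ n) (i : Fin n) : Equiv.Perm (Fin n × ZMod 2) :=
  if h : (i : ℕ) = 0 then tZero n hn else tGen n i (by omega) i.2

theorem TD_apply (n : ℕ) (hn : 2 ≤ n) (i k : Fin n) (e : ZMod 2) :
    TD n hn i (k, e) = if (i : ℕ) = 0 then (if (k : ℕ) = 0 then (⟨1, hn⟩, e + 1) else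
      if (k : ℕ) = 1 then (⟨0, Nat.lt_of_lt_of_le Nat.zero_lt_two hn⟩, e + 1) else (k, e)) else
      (if (k : ℕ) = i - 1 then i else
      if (k : ℕ) = i then ⟨i - 1, by omega⟩ else k, e) := by
  unfold TD
  split_ifs with h <;> simp_all [tZero_apply, tGen_apply]

theorem TD_mem (n : ℕ) (hn : 2 ≤ n) (i : Fin n) : TD n hn i ∈ hyperD n := by
  refine ⟨?_, ?_⟩
  · change _ ∈ Subgroup.centralizer {negPerm n}
    rw [Subgroup.mem_centralizer_singleton_iff]
    ext1 ⟨k, e⟩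
    simp only [Equiv.Perm.mul_apply]
    have : ∀ k e, negPerm n (k, e) = (k, e + 1) := fun _ _ => rfl
    simp only [this, TD_apply]
    split_ifs <;> simp
  · change _ ∈ alternatingGroup _
    rw [Equiv.Perm.mem_alternatingGroup]
    unfold TD tZero tGen
    split_ifs with h
    · rw [Equiv.Perm.sign_mul, Equiv.Perm.sign_swap, Equiv.Perm.sign_swap] <;> simp
    · rw [Equiv.Perm.sign_mul, Equiv.Perm.sign_swap, Equiv.Perm.sign_swap] <;>
        simp [Fin.ext_iff] <;> omega

def F1 (i k : ℕ) : ℕ := if i = 0 then (if k = 0 then 1 else if k = 1 then 0 else k) else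
  (if k = i - 1 then i else if k = i then i - 1 else k)

def F2 (i k : ℕ) (e : ZMod 2) : ZMod 2 := if i = 0 ∧ k ≤ 1 then e + 1 else e

theorem TD_fst (n : ℕ) (hn : 2 ≤ n) (i : Fin n) (x : Fin n × ZMod 2) :
    ((TD n hn i x).1 : ℕ) = F1 i x.1 := by
  obtain ⟨k, e⟩ := x
  rw [TD_apply]
  unfold F1
  split_ifs <;> rfl

theorem TD_snd (n : ℕ) (hn : 2 ≤ n) (i : Fin n) (x : Fin n × ZMod 2) :
    (TD n hn i x).2 = F2 i x.1 x.2 := by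
  obtain ⟨k, e⟩ := x
  rw [TD_apply]
  unfold F2
  split_ifs <;> first | rfl | (exfalso; dsimp only at *; omega)

theorem TD_sq (n : ℕ) (hn : 2 ≤ n) (i : Fin n) : TD n hn i * TD n hn i = 1 := by
  have z2 : ∀ e : ZMod 2, e + 1 + 1 = e := by decide
  refine Equiv.ext fun x => Prod.ext (Fin.ext ?_) ?_
  · simp only [Equiv.Perm.mul_apply, TD_fst, Equiv.Perm.one_apply]
    unfold F1; grind
  · rw [Equiv.Perm.mul_apply, TD_snd, TD_snd, TD_fst, Equiv.Perm.one_apply]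
    unfold F2 F1; grind

theorem TD_comm (n : ℕ) (hn : 2 ≤ n) (i j : Fin n) (hij : (i : ℕ) < j) (h : ¬ AdjD i j) :
    TD n hn i * TD n hn j = TD n hn j * TD n hn i := by
  unfold AdjD at h
  refine Equiv.ext fun x => Prod.ext (Fin.ext ?_) ?_
  · simp only [Equiv.Perm.mul_apply, TD_fst]
    unfold F1; grind
  · simp only [Equiv.Perm.mul_apply, TD_fst, TD_snd]
    unfold F2 F1; grind

theorem TD_braid (n : ℕ) (hn : 2 ≤ n) (i j : Fin n) (h : AdjD i j) :
    TD n hn i * TD n hn j * TD n hn i = TD n hn j * TD n hn i * TD n hn j := by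
  unfold AdjD at h
  refine Equiv.ext fun x => Prod.ext (Fin.ext ?_) ?_
  · simp only [Equiv.Perm.mul_apply, TD_fst]
    unfold F1; grind
  · simp only [Equiv.Perm.mul_apply, TD_fst, TD_snd]
    unfold F2 F1; grind

theorem MD_lt (n : ℕ) (i j : Fin n) (h : (i : ℕ) < j) :
    (AdjD i j → (MD n).M i j = 3) ∧ (¬ AdjD i j → (MD n).M i j = 2) := by
  unfold AdjD
  simp only [MD, Matrix.of_apply]
  constructor <;> intro h' <;> split_ifs <;> omega

/-- the generators, in the even signed permutation group -/
def TDs (n : ℕ) (hn : 2 ≤ n) (i : Fin n) : hyperD n := ⟨TD n hn i, TD_mem n hn i⟩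

theorem TDs_liftable (n : ℕ) (hn : 2 ≤ n) : (MD n).IsLiftable (TDs n hn) := by
  have sq : ∀ i, TDs n hn i * TDs n hn i = 1 := fun i => Subtype.ext (TD_sq n hn i)
  have key : ∀ i j : Fin n, (i : ℕ) < j → (TDs n hn i * TDs n hn j) ^ (MD n).M i j = 1 := by
    intro i j hij
    by_cases h : AdjD i j
    · have br : TDs n hn i * TDs n hn j * TDs n hn i = TDs n hn j * TDs n hn i * TDs n hn j :=
        Subtype.ext (TD_braid n hn i j h)
      rw [(MD_lt n i j hij).1 h]
      calc _ = (TDs n hn i * TDs n hn j * TDs n hn i) *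
            (TDs n hn j * TDs n hn i * TDs n hn j) := by simp only [pow_succ, pow_zero, one_mul, mul_assoc]
        _ = (TDs n hn i * TDs n hn j * TDs n hn i) * (TDs n hn i * TDs n hn j * TDs n hn i) := by
          rw [← br]
        _ = TDs n hn i * (TDs n hn j * (TDs n hn i * TDs n hn i) * TDs n hn j) * TDs n hn i := by
          simp only [mul_assoc]
        _ = 1 := by simp [sq]
    · have br : TDs n hn i * TDs n hn j = TDs n hn j * TDs n hn i :=
        Subtype.ext (TD_comm n hn i j hij h)
      rw [(MD_lt n i j hij).2 h, pow_two]
      nth_rewrite 1 [br]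
      rw [mul_assoc, ← mul_assoc (TDs n hn i), sq, one_mul, sq]
  intro i j
  rcases lt_trichotomy (i : ℕ) j with h | h | h
  · exact key i j h
  · have : i = j := Fin.ext h
    subst this
    rw [sq, one_pow]
  · have e := key j i h
    have e2 : (MD n).M i j = (MD n).M j i := (MD n).symmetric i j
    rw [show (MD n) i j = (MD n).M i j from rfl, e2]
    have e3 : TDs n hn i * TDs n hn j = (TDs n hn j * TDs n hn i)⁻¹ := by
      rw [mul_inv_rev, inv_eq_of_mul_eq_one_right (sq i), inv_eq_of_mul_eq_one_right (sq j)]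
    rw [e3, inv_pow, e, inv_one]

def phiD (n : ℕ) (hn : 2 ≤ n) : (MD n).Group →* hyperD n :=
  (MD n).toCoxeterSystem.lift ⟨TDs n hn, TDs_liftable n hn⟩

theorem phiD_simple (n : ℕ) (hn : 2 ≤ n) (i : Fin n) :
    phiD n hn ((MD n).simple i) = TDs n hn i := by
  have := (MD n).toCoxeterSystem.lift_apply_simple (TDs_liftable n hn) i
  rwa [CoxeterMatrix.toCoxeterSystem_simple] at this

theorem simple_sqD (n : ℕ) (i : Fin n) : (MD n).simple i * (MD n).simple i = 1 := by
  have := (MD n).toCoxeterSystem.simple_mul_simple_self i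
  rwa [CoxeterMatrix.toCoxeterSystem_simple] at this

theorem simple_powD (n : ℕ) (i j : Fin n) :
    ((MD n).simple i * (MD n).simple j) ^ (MD n).M i j = 1 := by
  have := (MD n).toCoxeterSystem.simple_mul_simple_pow i j
  rwa [CoxeterMatrix.toCoxeterSystem_simple] at this

theorem simple_commD (n : ℕ) (i j : Fin n) (hij : (i : ℕ) < j) (h : ¬ AdjD i j) :
    (MD n).simple i * (MD n).simple j = (MD n).simple j * (MD n).simple i := by
  have e := simple_powD n i j
  rw [(MD_lt n i j hij).2 h, pow_two] at e
  have e' := eq_inv_of_mul_eq_one_left e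
  rw [mul_inv_rev, inv_eq_of_mul_eq_one_right (simple_sqD n i),
    inv_eq_of_mul_eq_one_right (simple_sqD n j)] at e'
  exact e'

theorem simple_braidD (n : ℕ) (i j : Fin n) (hij : (i : ℕ) < j) (h : AdjD i j) :
    (MD n).simple i * (MD n).simple j * (MD n).simple i =
      (MD n).simple j * (MD n).simple i * (MD n).simple j := by
  have e := simple_powD n i j
  rw [(MD_lt n i j hij).1 h] at e
  have e1 : ((MD n).simple i * (MD n).simple j * (MD n).simple i) *
      ((MD n).simple j * (MD n).simple i * (MD n).simple j) = 1 := by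
    rw [← e]; simp only [pow_succ, pow_zero, one_mul, mul_assoc]
  have e' := eq_inv_of_mul_eq_one_left e1
  rw [mul_inv_rev, mul_inv_rev, inv_eq_of_mul_eq_one_right (simple_sqD n i),
    inv_eq_of_mul_eq_one_right (simple_sqD n j)] at e'
  rw [e', mul_assoc]

/-- parabolic subgroups (trivial for `m ≤ 1`) -/
def HD (n m : ℕ) : Subgroup (MD n).Group :=
  Subgroup.closure {g | ∃ i : Fin n, (i : ℕ) < m ∧ 2 ≤ m ∧ g = (MD n).simple i}

theorem stepD (n : ℕ) (hn : 2 ≤ n) (m : ℕ) (hm : 1 ≤ m) (hmn : m < n)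
    (w : (MD n).Group) (hw : w ∈ HD n (m + 1)) (h1 : phiD n hn w = 1) : w ∈ HD n m := by
  let σ : ℕ → (MD n).Group := fun i => if h : i < n then (MD n).simple ⟨i, h⟩ else 1
  have hσ : ∀ i (h : i < n), σ i = (MD n).simple ⟨i, h⟩ := fun i h => by simp [σ, h]
  obtain ⟨p, hp0, hA, hB, hC, hE⟩ := abs_act (X := (MD n).Group ⧸ HD n m) (fun i x => σ i • x) m hm
    ((1 : (MD n).Group) : (MD n).Group ⧸ HD n m)
    (by
      intro i hi x
      rw [smul_smul, hσ i (by omega), simple_sqD, one_smul])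
    (by
      intro i j hij hj h x
      rw [smul_smul, smul_smul, hσ i (by omega), hσ j (by omega), simple_commD _ _ _ hij h])
    (by
      intro i j h hj x
      have hij : i < j := by unfold AdjD at h; omega
      simp only [smul_smul]
      rw [hσ i (by omega), hσ j (by omega), ← mul_assoc, ← mul_assoc,
        simple_braidD _ _ _ hij h])
    (by
      intro i hi h2
      change ((σ i * 1 : (MD n).Group) : (MD n).Group ⧸ HD n m) = _
      rw [QuotientGroup.eq, hσ i (by omega)]
      rw [mul_one, mul_one, inv_mem_iff]
      exact Subgroup.subset_closure ⟨⟨i, by omega⟩, hi, h2, rfl⟩)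
  have main : ∀ w ∈ HD n (m + 1), ∀ x : Fin n × ZMod 2, (x.1 : ℕ) ≤ m →
      (((phiD n hn w).1 x).1 : ℕ) ≤ m ∧
      w • p x.1 x.2 = p ((phiD n hn w).1 x).1 ((phiD n hn w).1 x).2 := by
    intro w hw
    have gen : ∀ i : Fin n, (i : ℕ) < m + 1 → ∀ x : Fin n × ZMod 2, (x.1 : ℕ) ≤ m →
      (((phiD n hn ((MD n).simple i)).1 x).1 : ℕ) ≤ m ∧
      (MD n).simple i • p x.1 x.2 = p ((phiD n hn ((MD n).simple i)).1 x).1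
        ((phiD n hn ((MD n).simple i)).1 x).2 := by
      intro i hi x hx
      rw [phiD_simple]
      change ((TD n hn i x).1 : ℕ) ≤ m ∧ _ = p (TD n hn i x).1 (TD n hn i x).2
      rw [TD_fst, TD_snd]
      have hs : (MD n).simple i = σ i := (hσ i i.2).symm
      rw [hs]
      by_cases hi0 : (i : ℕ) = 0
      · rw [hi0]
        by_cases k0 : (x.1 : ℕ) = 0
        · rw [k0]; exact ⟨by simp [F1, hm], by simpa [F1, F2] using hA x.2⟩
        · by_cases k1 : (x.1 : ℕ) = 1
          · rw [k1]; exact ⟨by simp [F1], by simpa [F1, F2] using hB x.2⟩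
          · have k2 : ¬ (x.1 : ℕ) ≤ 1 := by omega
            exact ⟨by simp [F1, k0, k1, hx],
              by simpa [F1, F2, k0, k1, k2] using hC x.1 x.2 (by omega) hx⟩
      · refine ⟨?_, ?_⟩
        · unfold F1; split_ifs <;> omega
        · simpa [F1, F2, hi0] using hE i x.1 x.2 (by omega) (by omega) hx
    refine Subgroup.closure_induction'' (p := fun w _ => ∀ x : Fin n × ZMod 2, (x.1 : ℕ) ≤ m →
      (((phiD n hn w).1 x).1 : ℕ) ≤ m ∧
      w • p x.1 x.2 = p ((phiD n hn w).1 x).1 ((phiD n hn w).1 x).2) ?_ ?_ ?_ ?_ hw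
    · rintro _ ⟨i, hi, -, rfl⟩
      exact gen i hi
    · rintro _ ⟨i, hi, -, rfl⟩
      rw [inv_eq_of_mul_eq_one_right (simple_sqD n i)]
      exact gen i hi
    · intro x hx
      simp only [map_one, one_smul]
      exact ⟨hx, rfl⟩
    · intro a b _ _ ha hb x hx
      obtain ⟨hb1, hb2⟩ := hb x hx
      obtain ⟨ha1, ha2⟩ := ha _ hb1
      rw [mul_smul, hb2, ha2, map_mul]
      exact ⟨ha1, rfl⟩
  have e := (main w hw (⟨m, hmn⟩, 0) le_rfl).2
  rw [h1] at e
  change w • p m 0 = p m 0 at e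
  rw [hp0] at e
  have : ((w * 1 : (MD n).Group) : (MD n).Group ⧸ HD n m) = ((1 : (MD n).Group) : (MD n).Group ⧸ HD n m) := e
  rw [QuotientGroup.eq] at this
  simpa using this

theorem injD (n : ℕ) (hn : 2 ≤ n) : Function.Injective (phiD n hn) := by
  rw [injective_iff_map_eq_one]
  intro w hw
  have key : ∀ k, k + 1 ≤ n → ∀ w ∈ HD n (k + 1), phiD n hn w = 1 → w = 1 := by
    intro k
    induction k with
    | zero =>
      intro _ w hw _
      have : HD n (0 + 1) = ⊥ := by
        unfold HD
        rw [Subgroup.closure_eq_bot_iff]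
        rintro g ⟨i, hi, h2, -⟩
        omega
      rw [this] at hw
      exact hw
    | succ k ih =>
      intro hk w hw h1
      exact ih (by omega) w (stepD n hn (k + 1) (by omega) (by omega) w hw h1) h1
  refine key (n - 1) (by omega) w ?_ hw
  have : HD n (n - 1 + 1) = ⊤ := by
    rw [eq_top_iff, ← (MD n).toCoxeterSystem.subgroup_closure_range_simple]
    unfold HD
    apply Subgroup.closure_mono
    rintro _ ⟨i, rfl⟩
    rw [CoxeterMatrix.toCoxeterSystem_simple]
    exact ⟨i, by omega, by omega, rfl⟩
  rw [this]
  exact Subgroup.mem_top w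

theorem reachD (n : ℕ) (hn : 2 ≤ n) (m : ℕ) (hm : 1 ≤ m) (hmn : m < n) (x : Fin n × ZMod 2)
    (hx : (x.1 : ℕ) ≤ m) : ∃ w : (MD n).Group, (phiD n hn w).1 (⟨m, hmn⟩, 0) = x ∧
      ∀ y : Fin n × ZMod 2, m < (y.1 : ℕ) → (phiD n hn w).1 y = y := by
  let R : Fin n × ZMod 2 → Prop := fun x => ∃ w : (MD n).Group,
    (phiD n hn w).1 (⟨m, hmn⟩, 0) = x ∧
      ∀ y : Fin n × ZMod 2, m < (y.1 : ℕ) → (phiD n hn w).1 y = y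
  have step : ∀ (i : Fin n) x x', (i : ℕ) ≤ m → R x → F1 i x.1 = x'.1 → F2 i x.1 x.2 = x'.2 →
      R x' := by
    rintro i x x' hi ⟨w, hw, hw'⟩ e1 e2
    have hx' : TD n hn i x = x' := by
      refine Prod.ext (Fin.ext ?_) ?_
      · rw [TD_fst, e1]
      · rw [TD_snd, e2]
    refine ⟨(MD n).simple i * w, ?_, ?_⟩
    · rw [map_mul, phiD_simple]
      change TD n hn i ((phiD n hn w).1 (⟨m, hmn⟩, 0)) = x'
      rw [hw, hx']
    · intro y hy
      rw [map_mul, phiD_simple]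
      change TD n hn i ((phiD n hn w).1 y) = y
      rw [hw' y hy]
      refine Prod.ext (Fin.ext ?_) ?_
      · rw [TD_fst]; unfold F1; split_ifs <;> omega
      · rw [TD_snd]; unfold F2; split_ifs
        · omega
        · rfl
  have h0 : ∀ k j (h : j + k = m), R (⟨j, by omega⟩, 0) := by
    intro k
    induction k with
    | zero =>
      intro j h
      have : j = m := by omega
      subst this
      exact ⟨1, by simp, by simp⟩
    | succ k ih =>
      intro j h
      refine step ⟨j + 1, by omega⟩ _ _ (by simp; omega) (ih (j+1) (by omega)) ?_ ?_
      · simp [F1]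
      · simp [F2]
  have h1 : ∀ j (h : j ≤ m), R (⟨j, by omega⟩, 1) := by
    intro j
    induction j with
    | zero =>
      intro h
      refine step ⟨0, by omega⟩ _ _ (by simp) (h0 (m - 1) 1 (by omega)) ?_ ?_
      · simp [F1]
      · simp [F2]
    | succ j ih =>
      intro h
      refine step ⟨j + 1, by omega⟩ _ _ (by simp; omega) (ih (by omega)) ?_ ?_
      · simp [F1]
      · simp [F2]
  have dich : ∀ e : ZMod 2, e = 0 ∨ e = 1 := by decide
  obtain ⟨k, e⟩ := x
  rcases dich e with rfl | rfl
  · exact h0 (m - k) k (by dsimp only at hx; omega)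
  · exact h1 k hx

theorem hyperB_comm (n : ℕ) (g : hyperD n) (k : Fin n) (e : ZMod 2) :
    g.1 (k, e + 1) = ((g.1 (k, e)).1, (g.1 (k, e)).2 + 1) := by
  have h : g.1 ∈ Subgroup.centralizer {negPerm n} := g.2.1
  rw [Subgroup.mem_centralizer_singleton_iff] at h
  exact congrArg (fun f : Equiv.Perm (Fin n × ZMod 2) => f (k, e)) h

theorem surjD (n : ℕ) (hn : 2 ≤ n) : Function.Surjective (phiD n hn) := by
  have dich : ∀ e : ZMod 2, e = 0 ∨ e = 1 := by decide
  have h0n : 0 < n := by omega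
  have z1 : (1 : ZMod 2) ≠ 0 := by decide
  have key : ∀ k, k + 1 ≤ n → ∀ g : hyperD n,
      (∀ y : Fin n × ZMod 2, k + 1 ≤ (y.1 : ℕ) → g.1 y = y) → ∃ w, phiD n hn w = g := by
    intro k
    induction k with
    | zero =>
      intro _ g hg
      refine ⟨1, ?_⟩
      rw [map_one]
      have c := hyperB_comm n g ⟨0, h0n⟩ 0
      have f1 : ∀ e, (g.1 (⟨0, h0n⟩, e)).1 = ⟨0, h0n⟩ := by
        intro e
        by_contra hne
        have h1 : 0 + 1 ≤ ((g.1 (⟨0, h0n⟩, e)).1 : ℕ) := by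
          by_contra hlt
          exact hne (Fin.ext (by dsimp only; omega))
        have := g.1.injective (hg _ h1)
        rw [this] at hne
        exact hne rfl
      rcases dich (g.1 (⟨0, h0n⟩, 0)).2 with h | h
      · have e0 : g.1 (⟨0, h0n⟩, 0) = (⟨0, h0n⟩, 0) := Prod.ext (f1 0) h
        rw [e0] at c
        apply Subtype.ext
        refine Equiv.ext fun ⟨y, e⟩ => ?_
        by_cases hy : (y : ℕ) = 0
        · have : y = ⟨0, h0n⟩ := Fin.ext hy
          subst this
          rcases dich e with rfl | rfl
          · exact e0.symm
          · simpa using c.symm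
        · exact (hg (y, e) (by dsimp only; omega)).symm
      · exfalso
        have e0 : g.1 (⟨0, h0n⟩, 0) = (⟨0, h0n⟩, 1) := Prod.ext (f1 0) h
        rw [e0] at c
        have hs : g.1 = sZero n (by omega) := by
          refine Equiv.ext fun ⟨y, e⟩ => ?_
          unfold sZero
          by_cases hy : (y : ℕ) = 0
          · have : y = ⟨0, h0n⟩ := Fin.ext hy
            subst this
            rcases dich e with rfl | rfl
            · rw [e0, Equiv.swap_apply_left]
            · rw [Equiv.swap_apply_right]
              have z2 : (1 : ZMod 2) + 1 = 0 := by decide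
              simpa [z2] using c
          · rw [hg (y, e) (by dsimp only; omega), Equiv.swap_apply_of_ne_of_ne]
            · simp [Fin.ext_iff, hy]
            · simp [Fin.ext_iff, hy]
        have hsg : g.1 ∈ alternatingGroup (Fin n × ZMod 2) := g.2.2
        rw [Equiv.Perm.mem_alternatingGroup, hs, sZero, Equiv.Perm.sign_swap (by simp)] at hsg
        exact absurd hsg (by decide)
    | succ k ih =>
      intro hk g hg
      have hk1 : k + 1 < n := by omega
      have hle : ((g.1 (⟨k + 1, hk1⟩, 0)).1 : ℕ) ≤ k + 1 := by
        by_contra hne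
        have := g.1.injective (hg (g.1 (⟨k + 1, hk1⟩, 0)) (by omega))
        rw [this] at hne
        exact hne le_rfl
      obtain ⟨w, hw1, hw2⟩ := reachD n hn (k + 1) (by omega) (by omega) _ hle
      have hg1 : ((phiD n hn w)⁻¹ * g).1 (⟨k + 1, hk1⟩, 0) = (⟨k + 1, hk1⟩, 0) := by
        change (phiD n hn w).1⁻¹ (g.1 _) = _
        rw [Equiv.Perm.inv_eq_iff_eq]
        exact hw1.symm
      obtain ⟨v, hv⟩ := ih (by omega) ((phiD n hn w)⁻¹ * g) (by
        rintro ⟨y, e⟩ hy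
        by_cases h : (y : ℕ) = k + 1
        · have : y = ⟨k + 1, hk1⟩ := Fin.ext h
          subst this
          rcases dich e with rfl | rfl
          · exact hg1
          · have c := hyperB_comm n ((phiD n hn w)⁻¹ * g) ⟨k + 1, hk1⟩ 0
            rw [hg1] at c
            simpa using c
        · have h2 : k + 1 + 1 ≤ (y : ℕ) := by dsimp only at hy; omega
          change (phiD n hn w).1⁻¹ (g.1 _) = _
          rw [hg (y, e) h2, Equiv.Perm.inv_eq_iff_eq]
          exact (hw2 (y, e) h2).symm)
      exact ⟨w * v, by rw [map_mul, hv, mul_inv_cancel_left]⟩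
  intro g
  exact key (n - 1) (by omega) g (by intro y hy; have := y.1.2; omega)

/-- the Coxeter group of type `Dₙ` is isomorphic to the group `Dₙ'` of even
signed permutations, via `t₀ᵂ ↦ t₀` and `tᵢᵂ ↦ tᵢ`. -/
theorem coxeterD_iso_hyperD (n : ℕ) (hn : 2 ≤ n) :
    ∃ e : (MD n).Group ≃* hyperD n,
      ((e ((MD n).simple ⟨0, by omega⟩) : hyperD n) : Equiv.Perm (Fin n × ZMod 2))
        = tZero n hn ∧
      ∀ (i : ℕ) (h1 : 1 ≤ i) (h2 : i < n),
        ((e ((MD n).simple ⟨i, h2⟩) : hyperD n) : Equiv.Perm (Fin n × ZMod 2))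
          = tGen n i h1 h2 := by
  have hb : Function.Bijective (phiD n hn) := ⟨injD n hn, surjD n hn⟩
  refine ⟨MulEquiv.ofBijective (phiD n hn) hb, ?_, ?_⟩
  · change (phiD n hn ((MD n).simple ⟨0, _⟩)).1 = _
    rw [phiD_simple]
    simp [TDs, TD]
  · intro i h1 h2
    change (phiD n hn ((MD n).simple ⟨i, h2⟩)).1 = _
    rw [phiD_simple]
    have : i ≠ 0 := by omega
    simp [TDs, TD, this]
end

section
/- Let n ≥ 1. There exists a unique group homomorphism p : W(Bₙ) → Equiv.Perm (Fin n) with p(s₀ᵂ) = 1 and p(sᵢᵂ) = Equiv.swap (i − 1) i for all 1 ≤ i ≤ n − 1. This homomorphism p is surjective, its kernel has cardinality 2ⁿ, and every element of its kernel squares to the identity. (This is the natural epimorphism π : Bₙ → Σₙ, whose kernel is the elementary abelian group (ℤ/2)ⁿ.) -/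
structure BRel_s13 {G : Type*} [Group G] (s : ℕ → G) (n : ℕ) : Prop where
  sq : ∀ i < n, s i * s i = 1
  comm : ∀ i j, i + 1 < j → j < n → s i * s j = s j * s i
  braid : ∀ i, 1 ≤ i → i + 1 < n → s i * s (i+1) * s i = s (i+1) * s i * s (i+1)
  four : 1 < n → s 0 * s 1 * s 0 * s 1 = s 1 * s 0 * s 1 * s 0

section
variable {G : Type*} [Group G]

lemma BRel_s13.mono {s : ℕ → G} {n : ℕ} (h : BRel_s13 s (n+1)) : BRel_s13 s n :=
  ⟨fun i hi => h.sq i (by omega), fun i j hi hj => h.comm i j hi (by omega),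
    fun i h1 h2 => h.braid i h1 (by omega), fun h1 => h.four (by omega)⟩

def bD (s : ℕ → G) (n k : ℕ) : G := ((List.range' k (n + 1 - k)).map s).prod

lemma bD_top (s : ℕ → G) (n : ℕ) : bD s n (n+1) = 1 := by simp [bD]

lemma bD_step (s : ℕ → G) (n k : ℕ) (hk : k ≤ n) : bD s n k = s k * bD s n (k+1) := by
  unfold bD
  rw [show n + 1 - k = (n + 1 - (k+1)) + 1 by omega, List.range'_succ]
  simp

def bU (s : ℕ → G) (n : ℕ) : ℕ → G
  | 0 => bD s n 0
  | k+1 => s (k+1) * bU s n k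

variable {s : ℕ → G} {n : ℕ}

lemma bL1 (h : BRel_s13 s (n+1)) (i k : ℕ) (hk : k ≤ n + 1) :
    i + 1 < k → s i * bD s n k = bD s n k * s i := by
  induction hk using Nat.decreasingInduction with
  | self => intro _; simp [bD_top]
  | of_succ k hk ih =>
    intro hi
    rw [bD_step s n k (by omega), ← mul_assoc, h.comm i k hi (by omega), mul_assoc,
      ih (by omega), mul_assoc]

lemma bL2 (h : BRel_s13 s (n+1)) (i : ℕ) (hi : 1 ≤ i) (hin : i + 1 ≤ n) (k : ℕ) (hk : k ≤ i) :
    s (i+1) * bD s n k = bD s n k * s i := by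
  induction hk using Nat.decreasingInduction with
  | self =>
    rw [bD_step s n i (by omega), bD_step s n (i+1) (by omega)]
    have h1 := bL1 h i (i+1+1) (by omega) (by omega)
    have h2 := h.braid i hi (by omega)
    calc _ = (s (i+1) * s i * s (i+1)) * bD s n (i+1+1) := by group
      _ = s i * s (i+1) * (s i * bD s n (i+1+1)) := by rw [← h2]; group
      _ = _ := by rw [h1]; group
  | of_succ k hk ih =>
    rw [bD_step s n k (by omega), ← mul_assoc, ← h.comm k (i+1) (by omega) (by omega), mul_assoc,
      ih, mul_assoc]

lemma bL3 (h : BRel_s13 s (n+1)) (i : ℕ) (hin : i + 1 ≤ n) (k : ℕ) (hk : k < i) :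
    s (i+1) * bU s n k = bU s n k * s i := by
  induction k with
  | zero => exact bL2 h i (by omega) hin 0 (by omega)
  | succ k ih =>
    rw [bU, ← mul_assoc, ← h.comm (k+1) (i+1) (by omega) (by omega), mul_assoc,
      ih (by omega), mul_assoc]

lemma bL4 (h : BRel_s13 s (n+1)) (i : ℕ) (k : ℕ) (hk : i + 2 ≤ k) :
    k ≤ n → s (i+1) * bU s n k = bU s n k * s (i+1) := by
  induction k, hk using Nat.le_induction with
  | base =>
    intro hn
    have h1 := bL3 h (i+1) (by omega) i (by omega)
    have h2 := h.braid (i+1) (by omega) (by omega)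
    calc _ = (s (i+1) * s (i+1+1) * s (i+1)) * bU s n i := by simp only [bU]; group
      _ = s (i+1+1) * s (i+1) * (s (i+1+1) * bU s n i) := by rw [h2]; group
      _ = _ := by rw [h1]; simp only [bU]; group
  | succ k hk ih =>
    intro hn
    rw [bU, ← mul_assoc, h.comm (i+1) (k+1) (by omega) (by omega), mul_assoc,
      ih (by omega), mul_assoc]

lemma bL5 (h : BRel_s13 s (n+1)) (k : ℕ) (hk : 1 ≤ k) :
    k ≤ n → s 0 * bU s n k = bU s n k * s 0 := by
  induction k, hk using Nat.le_induction with
  | base =>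
    intro hn
    have h1 := bL1 h 0 2 (by omega) (by omega)
    have h2 := h.four (by omega)
    have h3 : bU s n 1 = s 1 * (s 0 * (s 1 * bD s n 2)) := by
      simp only [bU]
      rw [bD_step s n 0 (by omega), bD_step s n 1 (by omega)]
    rw [h3]
    calc _ = (s 0 * s 1 * s 0 * s 1) * bD s n 2 := by group
      _ = s 1 * s 0 * s 1 * (s 0 * bD s n 2) := by rw [h2]; group
      _ = _ := by rw [h1]; group
  | succ k hk ih =>
    intro hn
    rw [bU, ← mul_assoc, h.comm 0 (k+1) (by omega) (by omega), mul_assoc,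
      ih (by omega), mul_assoc]

lemma b_coset (h : BRel_s13 s (n+1)) (H : Subgroup G) (hH : ∀ i < n, s i ∈ H)
    (i : ℕ) (hi : i ≤ n) (x : G)
    (hx : (∃ k ≤ n + 1, ∃ y ∈ H, x = bD s n k * y) ∨ (∃ k < n, ∃ y ∈ H, x = bU s n (k+1) * y)) :
    (∃ k ≤ n + 1, ∃ y ∈ H, s i * x = bD s n k * y) ∨
      (∃ k < n, ∃ y ∈ H, s i * x = bU s n (k+1) * y) := by
  rcases hx with ⟨k, hk, y, hy, rfl⟩ | ⟨k, hk, y, hy, rfl⟩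
  · rcases lt_trichotomy i k with hik | rfl | hik
    · by_cases e : i + 1 = k
      · subst e
        left
        exact ⟨i, by omega, y, hy, by rw [bD_step s n i (by omega), mul_assoc]⟩
      · left
        exact ⟨k, hk, s i * y, H.mul_mem (hH _ (by omega)) hy, by
          rw [← mul_assoc, bL1 h i k hk (by omega), mul_assoc]⟩
    · left
      exact ⟨i+1, by omega, y, hy, by
        rw [bD_step s n i (by omega), ← mul_assoc, ← mul_assoc, h.sq i (by omega), one_mul]⟩
    · obtain ⟨j, rfl⟩ : ∃ j, i = j + 1 := ⟨i - 1, by omega⟩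
      rcases Nat.eq_zero_or_pos j with rfl | hj
      · obtain rfl : k = 0 := by omega
        right
        exact ⟨0, by omega, y, hy, by simp only [bU, mul_assoc]⟩
      · left
        exact ⟨k, hk, s j * y, H.mul_mem (hH _ (by omega)) hy, by
          rw [← mul_assoc, bL2 h j hj hi k (by omega), mul_assoc]⟩
  · rcases lt_trichotomy i (k+1) with hik | rfl | hik
    · right
      refine ⟨k, hk, s i * y, H.mul_mem (hH _ (by omega)) hy, ?_⟩
      rw [← mul_assoc, ← mul_assoc]
      congr 1
      rcases i with _ | i
      · exact bL5 h _ (by omega) (by omega)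
      · exact bL4 h i _ (by omega) (by omega)
    · have : s (k+1) * (bU s n (k+1) * y) = bU s n k * y := by
        rw [bU, ← mul_assoc, ← mul_assoc, h.sq _ (by omega), one_mul]
      rw [this]
      rcases k with _ | k
      · left
        exact ⟨0, by omega, y, hy, rfl⟩
      · right
        exact ⟨k, by omega, y, hy, rfl⟩
    · right
      by_cases e : i = k + 2
      · subst e
        exact ⟨k+1, by omega, y, hy, by rw [← mul_assoc]; rfl⟩
      · obtain ⟨j, rfl⟩ : ∃ j, i = j + 1 := ⟨i - 1, by omega⟩
        exact ⟨k, hk, s j * y, H.mul_mem (hH _ (by omega)) hy, by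
          rw [← mul_assoc, bL3 h j hi _ (by omega), mul_assoc]⟩

open scoped Pointwise in
lemma b_bound (s : ℕ → G) (n : ℕ) (h : BRel_s13 s n) :
    ∃ F : Finset G, F.card ≤ 2 ^ n * n.factorial ∧
      ((Subgroup.closure (s '' Set.Iio n) : Subgroup G) : Set G) ⊆ F := by
  classical
  induction n with
  | zero => exact ⟨{1}, by simp, by simp⟩
  | succ n ih =>
    obtain ⟨F, hF, hF'⟩ := ih h.mono
    set H := Subgroup.closure (s '' Set.Iio n)
    have hH : ∀ i < n, s i ∈ H := fun i hi => Subgroup.subset_closure ⟨i, hi, rfl⟩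
    refine ⟨((Finset.range (n+2)).image (bD s n) ∪ (Finset.range n).image (fun k => bU s n (k+1)))
      * F, ?_, ?_⟩
    · refine Finset.card_mul_le.trans ?_
      have h1 : ((Finset.range (n+2)).image (bD s n) ∪
          (Finset.range n).image (fun k => bU s n (k+1))).card ≤ 2 * (n+1) := by
        refine (Finset.card_union_le _ _).trans ?_
        have a := Finset.card_image_le (s := Finset.range (n+2)) (f := bD s n)
        have b := Finset.card_image_le (s := Finset.range n) (f := fun k => bU s n (k+1))
        simp only [Finset.card_range] at a b
        omega
      calc _ ≤ (2 * (n+1)) * (2 ^ n * n.factorial) := Nat.mul_le_mul h1 hF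
        _ = _ := by rw [Nat.factorial_succ]; ring
    · have key : ∀ x ∈ Subgroup.closure (s '' Set.Iio (n+1)),
          (∃ k ≤ n + 1, ∃ y ∈ H, x = bD s n k * y) ∨
          (∃ k < n, ∃ y ∈ H, x = bU s n (k+1) * y) := by
        intro x hx
        induction hx using Subgroup.closure_induction_left with
        | one => exact Or.inl ⟨n+1, le_rfl, 1, H.one_mem, by simp [bD_top]⟩
        | mul_left a ha y hy ihy =>
          obtain ⟨i, hi, rfl⟩ := ha
          exact b_coset h H hH i (Nat.lt_succ_iff.mp hi) y ihy
        | inv_mul_cancel a ha y hy ihy =>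
          obtain ⟨i, hi, rfl⟩ := ha
          rw [inv_eq_of_mul_eq_one_right (h.sq i hi)]
          exact b_coset h H hH i (Nat.lt_succ_iff.mp hi) y ihy
      intro x hx
      rw [Finset.mem_coe, Finset.mem_mul]
      rcases key x hx with ⟨k, hk, y, hy, rfl⟩ | ⟨k, hk, y, hy, rfl⟩
      · exact ⟨_, Finset.mem_union_left _ (Finset.mem_image_of_mem _
          (Finset.mem_range.mpr (by omega))), y, hF' hy, rfl⟩
      · exact ⟨_, Finset.mem_union_right _ (Finset.mem_image_of_mem (fun k => bU s n (k+1))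
          (Finset.mem_range.mpr hk)), y, hF' hy, rfl⟩
end

section
variable {G : Type*} [Group G]

lemma inv_of_sq {x : G} (hx : x * x = 1) : x⁻¹ = x := inv_eq_of_mul_eq_one_right hx

lemma rel2 {x y : G} (hx : x * x = 1) (hy : y * y = 1) (h : (x * y) ^ 2 = 1) :
    x * y = y * x := by
  have : (x * y) * (x * y) = 1 := by rw [← h, pow_two]
  have := inv_of_sq this
  rw [mul_inv_rev, inv_of_sq hx, inv_of_sq hy] at this
  exact this.symm

lemma rel3 {x y : G} (hx : x * x = 1) (hy : y * y = 1) (h : (x * y) ^ 3 = 1) :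
    x * y * x = y * x * y := by
  have : (x * y * x) * (y * x * y) = 1 := by rw [← h]; simp only [pow_succ, pow_zero, one_mul, mul_assoc]
  have := inv_eq_of_mul_eq_one_right this
  rw [← this]
  simp only [mul_inv_rev, inv_of_sq hx, inv_of_sq hy, mul_assoc]

lemma rel4 {x y : G} (hx : x * x = 1) (hy : y * y = 1) (h : (x * y) ^ 4 = 1) :
    x * y * x * y = y * x * y * x := by
  have : (x * y * x * y) * (x * y * x * y) = 1 := by rw [← h]; simp only [pow_succ, pow_zero, one_mul, mul_assoc]
  have := inv_eq_of_mul_eq_one_right this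
  rw [← this]
  simp only [mul_inv_rev, inv_of_sq hx, inv_of_sq hy, mul_assoc]

lemma pow_comm_rel {x y : G} {m : ℕ} (h : (x * y) ^ m = 1) : (y * x) ^ m = 1 := by
  have : (y * x) ^ m = x⁻¹ * (x * y) ^ m * x := by
    rw [show y * x = x⁻¹ * (x * y) * x⁻¹⁻¹ by group, conj_pow]; group
  rw [this, h]; group
end

lemma MB_val (n : ℕ) (i j : Fin n) : (MB n).M i j =
    if (i : ℕ) = (j : ℕ) then 1
    else if ((i : ℕ) = 0 ∧ (j : ℕ) = 1) ∨ ((i : ℕ) = 1 ∧ (j : ℕ) = 0) then 4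
    else if (1 ≤ (i : ℕ) ∧ 1 ≤ (j : ℕ)) ∧ ((i : ℕ) + 1 = (j : ℕ) ∨ (j : ℕ) + 1 = (i : ℕ)) then 3
    else 2 := rfl

/-- Natural-number indexed simple reflections. -/
noncomputable def sW (n i : ℕ) : (MB n).Group := if h : i < n then (MB n).simple ⟨i, h⟩ else 1

lemma sW_pow (n i j m : ℕ) (hi : i < n) (hj : j < n)
    (hm : (MB n).M ⟨i, hi⟩ ⟨j, hj⟩ = m) : (sW n i * sW n j) ^ m = 1 := by
  have := (MB n).toCoxeterSystem.simple_mul_simple_pow ⟨i, hi⟩ ⟨j, hj⟩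
  simp only [CoxeterMatrix.toCoxeterSystem_simple] at this
  rw [sW, sW, dif_pos hi, dif_pos hj, ← hm]
  exact this

lemma sW_rel (n : ℕ) : BRel_s13 (sW n) n := by
  have sq : ∀ i < n, sW n i * sW n i = 1 := fun i hi => by
    simpa using sW_pow n i i 1 hi hi (by simp [MB_val])
  refine ⟨sq, fun i j hij hj => ?_, fun i h1 h2 => ?_, fun h => ?_⟩
  · refine rel2 (sq i (by omega)) (sq j hj) (sW_pow n i j 2 (by omega) hj ?_)
    rw [MB_val]; dsimp only; split_ifs <;> omega
  · refine rel3 (sq i (by omega)) (sq _ h2) (sW_pow n i (i+1) 3 (by omega) h2 ?_)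
    rw [MB_val, if_neg (by dsimp only; omega), if_neg (by dsimp only; omega),
      if_pos (by dsimp only; omega)]
  · refine rel4 (sq 0 (by omega)) (sq _ h) (sW_pow n 0 1 4 (by omega) h ?_)
    rw [MB_val]; simp

lemma sW_closure (n : ℕ) : Subgroup.closure (sW n '' Set.Iio n) = ⊤ := by
  rw [← (MB n).toCoxeterSystem.subgroup_closure_range_simple]
  congr 1
  ext x
  simp only [CoxeterMatrix.toCoxeterSystem_simple]
  constructor
  · rintro ⟨i, hi, rfl⟩
    exact ⟨⟨i, hi⟩, by rw [sW, dif_pos (Set.mem_Iio.mp hi)]⟩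
  · rintro ⟨i, rfl⟩
    exact ⟨i, i.2, by rw [sW, dif_pos i.2]⟩

lemma W_card (n : ℕ) : Finite (MB n).Group ∧ Nat.card (MB n).Group ≤ 2 ^ n * n.factorial := by
  obtain ⟨F, hF, hF'⟩ := b_bound _ n (sW_rel n)
  rw [sW_closure, Subgroup.coe_top] at hF'
  have fin : Finite (MB n).Group := Set.finite_univ_iff.mp (F.finite_toSet.subset hF')
  refine ⟨fin, ?_⟩
  rw [← Set.ncard_univ]
  refine (Set.ncard_le_ncard hF' F.finite_toSet).trans ?_
  rwa [Set.ncard_coe_finset]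

abbrev Z2 := Multiplicative (ZMod 2)

/-- The group of signed permutations. -/
abbrev SP (n : ℕ) := (Fin n → Z2) ⋊[mulAutArrow (G := Equiv.Perm (Fin n))] Equiv.Perm (Fin n)

lemma Z2_sq (x : Z2) : x * x = 1 := by revert x; decide

lemma act_single (n : ℕ) (σ : Equiv.Perm (Fin n)) (a : Fin n) (x : Z2) :
    mulAutArrow (M := Z2) σ (Pi.mulSingle a x) = Pi.mulSingle (σ a) x := by
  funext b
  change (Pi.mulSingle a x : Fin n → Z2) (σ⁻¹ b) = _
  rw [Pi.mulSingle_apply, Pi.mulSingle_apply]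
  simp only [Equiv.Perm.inv_eq_iff_eq]

def g2 : Z2 := Multiplicative.ofAdd 1

def aSwap (n : ℕ) (i : Fin n) : Equiv.Perm (Fin n) :=
  Equiv.swap (⟨i - 1, Nat.lt_of_le_of_lt (Nat.sub_le i 1) i.2⟩ : Fin n) i

def fS (n : ℕ) (i : Fin n) : SP n :=
  if (i : ℕ) = 0 then SemidirectProduct.inl (Pi.mulSingle i g2) else
    SemidirectProduct.inr (aSwap n i)

lemma inl_sq (n : ℕ) (v : Fin n → Z2) : (SemidirectProduct.inl v : SP n) *
    SemidirectProduct.inl v = 1 := by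
  rw [← map_mul, show v * v = 1 from funext fun i => Z2_sq _, map_one]

lemma aSwap_sq (n : ℕ) (i : Fin n) : aSwap n i * aSwap n i = 1 := by simp [aSwap]

lemma fS_sq (n : ℕ) (i : Fin n) : fS n i * fS n i = 1 := by
  unfold fS
  split_ifs
  · exact inl_sq n _
  · rw [← map_mul, aSwap_sq, map_one]

lemma fS_lt (n : ℕ) (i j : Fin n) (hij : (i : ℕ) < j) : (fS n i * fS n j) ^ (MB n).M i j = 1 := by
  rw [MB_val, if_neg (by omega)]
  have hj : (j : ℕ) ≠ 0 := by omega
  by_cases hi : (i : ℕ) = 0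
  · have e1 : fS n i = SemidirectProduct.inl (Pi.mulSingle i g2) := by simp [fS, hi]
    have e2 : fS n j = SemidirectProduct.inr (aSwap n j) := by simp [fS, hj]
    have hc : fS n j * fS n i * (fS n j)⁻¹ =
        SemidirectProduct.inl (Pi.mulSingle (aSwap n j i) g2) := by
      rw [e1, e2, ← act_single, SemidirectProduct.inl_aut, map_inv]
    rw [inv_of_sq (fS_sq n j)] at hc
    have e3 : (fS n i * fS n j) ^ 2 = SemidirectProduct.inl
        (Pi.mulSingle i g2 * Pi.mulSingle (aSwap n j i) g2) := by
      rw [map_mul, ← hc, ← e1]; simp only [pow_succ, pow_zero, one_mul, mul_assoc]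
    by_cases h1 : (j : ℕ) = 1
    · rw [if_pos (by omega), show 4 = 2 * 2 from rfl, pow_mul, e3, pow_two, inl_sq]
    · rw [if_neg (by omega), if_neg (by omega), e3]
      have : aSwap n j i = i := by
        apply Equiv.swap_apply_of_ne_of_ne <;> rw [Ne, Fin.ext_iff] <;> (try dsimp only) <;> omega
      rw [this, map_mul, inl_sq]
  · have e1 : fS n i = SemidirectProduct.inr (aSwap n i) := by simp [fS, hi]
    have e2 : fS n j = SemidirectProduct.inr (aSwap n j) := by simp [fS, hj]
    rw [e1, e2, if_neg (by omega), ← map_mul, ← map_pow]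
    rw [← map_one (SemidirectProduct.inr : Equiv.Perm (Fin n) →* SP n)]
    congr 1
    by_cases h1 : (i : ℕ) + 1 = j
    · rw [if_pos (by omega)]
      have hh : (⟨j - 1, Nat.lt_of_le_of_lt (Nat.sub_le j 1) j.2⟩ : Fin n) = i :=
        Fin.ext (by dsimp only; omega)
      unfold aSwap
      rw [hh, Equiv.swap_comm _ i]
      have := (Equiv.Perm.isThreeCycle_swap_mul_swap_same
        (a := i) (b := ⟨i - 1, Nat.lt_of_le_of_lt (Nat.sub_le i 1) i.2⟩) (c := j)
        (by rw [Ne, Fin.ext_iff]; dsimp only; omega) (by rw [Ne, Fin.ext_iff]; omega)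
        (by rw [Ne, Fin.ext_iff]; dsimp only; omega)).orderOf
      rw [← this, pow_orderOf_eq_one]
    · rw [if_neg (by omega)]
      have : Commute (aSwap n i) (aSwap n j) := by
        apply Equiv.Perm.Disjoint.commute
        apply Equiv.Perm.disjoint_swap_swap
        simp [Fin.ext_iff]
        omega
      rw [this.mul_pow, pow_two, pow_two, aSwap_sq, aSwap_sq, one_mul]

lemma fS_liftable (n : ℕ) : (MB n).IsLiftable (fS n) := by
  intro i j
  rcases lt_trichotomy (i : ℕ) j with h | h | h
  · exact fS_lt n i j h
  · obtain rfl := Fin.ext h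
    have : (MB n).M i i = 1 := by simp [MB_val]
    change _ ^ (MB n).M i i = 1
    rw [this, pow_one, fS_sq]
  · have := pow_comm_rel (fS_lt n j i h)
    rw [(MB n).isSymm.apply] at this
    exact this

noncomputable def phi (n : ℕ) : (MB n).Group →* SP n :=
  (MB n).toCoxeterSystem.lift ⟨fS n, fS_liftable n⟩

lemma phi_simple (n : ℕ) (i : Fin n) : phi n ((MB n).simple i) = fS n i :=
  (MB n).toCoxeterSystem.lift_apply_simple (fS_liftable n) i

lemma p_surj (n : ℕ) :
    Function.Surjective (SemidirectProduct.rightHom.comp (phi n)) := by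
  rcases n with _ | n
  · intro x; exact ⟨1, Subsingleton.elim _ _⟩
  · rw [← MonoidHom.mrange_eq_top, eq_top_iff,
      ← Equiv.Perm.mclosure_swap_castSucc_succ, Submonoid.closure_le]
    rintro _ ⟨i, rfl⟩
    refine ⟨(MB (n+1)).simple i.succ, ?_⟩
    rw [MonoidHom.comp_apply, phi_simple, fS, if_neg (by simp), SemidirectProduct.rightHom_inr]
    rfl

lemma phi_single (n : ℕ) (hn : 1 ≤ n) (a : Fin n) (x : Z2) :
    (SemidirectProduct.inl (Pi.mulSingle a x) : SP n) ∈ (phi n).range := by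
  have hx : x = 1 ∨ x = g2 := by revert x; decide
  rcases hx with rfl | rfl
  · rw [Pi.mulSingle_one, map_one]; exact one_mem _
  · obtain ⟨w, hw⟩ := p_surj n (Equiv.swap ⟨0, hn⟩ a)
    rw [MonoidHom.comp_apply] at hw
    refine ⟨w * (MB n).simple ⟨0, hn⟩ * w⁻¹, ?_⟩
    have e : phi n w = SemidirectProduct.inl (phi n w).left *
      SemidirectProduct.inr (Equiv.swap ⟨0, hn⟩ a) := by
      rw [← hw]; exact (SemidirectProduct.inl_left_mul_inr_right _).symm
    rw [map_mul, map_mul, map_inv, phi_simple, e, fS, if_pos rfl]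
    set v := (phi n w).left
    have h2 := SemidirectProduct.inl_aut (φ := mulAutArrow (M := Z2) (A := Fin n))
      (Equiv.swap (⟨0, hn⟩ : Fin n) a)
      (Pi.mulSingle ⟨0, hn⟩ g2)
    rw [act_single, Equiv.swap_apply_left, map_inv] at h2
    rw [mul_inv_rev]
    calc _ = SemidirectProduct.inl v * SemidirectProduct.inl (Pi.mulSingle a g2) *
          (SemidirectProduct.inl v)⁻¹ := by rw [h2]; group
      _ = _ := by rw [← map_inv, ← map_mul, ← map_mul]; congr 1; exact mul_inv_cancel_comm _ _

lemma phi_surj (n : ℕ) (hn : 1 ≤ n) : Function.Surjective (phi n) := by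
  have h1 : ∀ v : Fin n → Z2, (SemidirectProduct.inl v : SP n) ∈ (phi n).range := by
    intro v
    exact Subgroup.pi_mem_of_mulSingle_mem
      (H := (phi n).range.comap (SemidirectProduct.inl)) v (fun i => phi_single n hn i _)
  intro g
  obtain ⟨w, hw⟩ := p_surj n g.right
  have : g = SemidirectProduct.inl (g.left * (phi n w).left⁻¹) * phi n w := by
    conv_rhs => rhs; rw [← SemidirectProduct.inl_left_mul_inr_right (phi n w)]
    rw [← mul_assoc, ← map_mul, inv_mul_cancel_right,
      show (phi n w).right = g.right from hw, SemidirectProduct.inl_left_mul_inr_right]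
  rw [this]
  exact mul_mem (h1 _) ⟨w, rfl⟩

lemma phi_bij (n : ℕ) (hn : 1 ≤ n) : Function.Bijective (phi n) := by
  obtain ⟨fin, hc⟩ := W_card n
  refine (Nat.bijective_iff_surjective_and_card _).mpr ⟨phi_surj n hn, ?_⟩
  refine le_antisymm ?_ (Nat.card_le_card_of_surjective _ (phi_surj n hn))
  rw [SemidirectProduct.card]
  simpa [Nat.card_eq_fintype_card, Fintype.card_perm] using hc

/-- there is a unique homomorphism `p : W(Bₙ) → Σₙ` with `p(s₀ᵂ) = 1` and
`p(sᵢᵂ) = (i-1, i)` for `1 ≤ i ≤ n - 1`; it is surjective, and its kernel is elementary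
abelian of cardinality `2ⁿ`. -/
theorem coxeterB_projection_to_symmetric (n : ℕ) (hn : 1 ≤ n) :
    ∃ p : (MB n).Group →* Equiv.Perm (Fin n),
      (p ((MB n).simple ⟨0, hn⟩) = 1 ∧
        ∀ (i : ℕ) (_h1 : 1 ≤ i) (h2 : i < n),
          p ((MB n).simple ⟨i, h2⟩)
            = Equiv.swap (⟨i - 1, Nat.lt_of_le_of_lt (Nat.sub_le i 1) h2⟩ : Fin n) ⟨i, h2⟩) ∧
      (∀ q : (MB n).Group →* Equiv.Perm (Fin n),
        (q ((MB n).simple ⟨0, hn⟩) = 1 ∧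
          ∀ (i : ℕ) (_h1 : 1 ≤ i) (h2 : i < n),
            q ((MB n).simple ⟨i, h2⟩)
              = Equiv.swap (⟨i - 1, Nat.lt_of_le_of_lt (Nat.sub_le i 1) h2⟩ : Fin n) ⟨i, h2⟩) →
        q = p) ∧
      Function.Surjective p ∧
      Nat.card p.ker = 2 ^ n ∧
      (∀ g ∈ p.ker, g ^ 2 = 1) := by
  have hrest : ∀ (i : ℕ) (_h1 : 1 ≤ i) (h2 : i < n),
      (SemidirectProduct.rightHom.comp (phi n)) ((MB n).simple ⟨i, h2⟩)
        = Equiv.swap (⟨i - 1, Nat.lt_of_le_of_lt (Nat.sub_le i 1) h2⟩ : Fin n) ⟨i, h2⟩ := by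
    intro i h1 h2
    rw [MonoidHom.comp_apply, phi_simple, fS, if_neg (by dsimp only; omega),
      SemidirectProduct.rightHom_inr]
    rfl
  have hzero : (SemidirectProduct.rightHom.comp (phi n)) ((MB n).simple ⟨0, hn⟩) = 1 := by
    rw [MonoidHom.comp_apply, phi_simple, fS, if_pos rfl, SemidirectProduct.rightHom_inl]
  have hb := phi_bij n hn
  refine ⟨SemidirectProduct.rightHom.comp (phi n), ⟨hzero, hrest⟩, ?_, p_surj n, ?_, ?_⟩
  · rintro q ⟨q0, q1⟩
    apply (MB n).toCoxeterSystem.ext_simple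
    rintro ⟨i, hi⟩
    rw [CoxeterMatrix.toCoxeterSystem_simple]
    rcases Nat.eq_zero_or_pos i with rfl | h
    · rw [q0, hzero]
    · rw [q1 i h hi, hrest i h hi]
  · let e := MulEquiv.ofBijective (phi n) hb
    have h1 := Subgroup.card_mul_index (SemidirectProduct.rightHom.comp (phi n)).ker
    rw [Subgroup.index_ker, MonoidHom.range_eq_top.mpr (p_surj n), Nat.card_congr e.toEquiv,
      SemidirectProduct.card] at h1
    have h2 : Nat.card (⊤ : Subgroup (Equiv.Perm (Fin n))) = Nat.card (Equiv.Perm (Fin n)) := by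
      simp
    rw [h2] at h1
    rw [Nat.eq_of_mul_eq_mul_right Nat.card_pos h1]
    simp [Nat.card_eq_fintype_card]
  · intro g hg
    apply hb.1
    have h1 : phi n g ∈ (SemidirectProduct.rightHom : SP n →* _).ker := hg
    rw [← SemidirectProduct.range_inl_eq_ker_rightHom] at h1
    obtain ⟨v, hv⟩ := h1
    rw [map_pow, map_one, ← hv, pow_two, inl_sq]
end

section
/- For n ≥ 1, the Coxeter group W(Bₙ) of type Bₙ is finite of cardinality 2ⁿ · n!, and for n ≥ 2, the Coxeter group W(Dₙ) of type Dₙ is finite of cardinality 2^{n−1} · n!. -/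
namespace CoxBD

structure RelB {G : Type*} [Group G] (n : ℕ) (s : ℕ → G) : Prop where
  sq : ∀ i, i < n → s i * s i = 1
  comm : ∀ i j, i + 1 < j → j < n → s i * s j = s j * s i
  braid : ∀ i, 1 ≤ i → i + 1 < n → s i * s (i+1) * s i = s (i+1) * s i * s (i+1)
  braid4 : 1 < n → s 0 * s 1 * s 0 * s 1 = s 1 * s 0 * s 1 * s 0

structure RelD {G : Type*} [Group G] (n : ℕ) (s : ℕ → G) : Prop where
  sq : ∀ i, i < n → s i * s i = 1
  comm : ∀ i j, i + 1 < j → j < n → ¬ (i = 0 ∧ j = 2) → s i * s j = s j * s i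
  comm0 : 1 < n → s 0 * s 1 = s 1 * s 0
  braid : ∀ i, 1 ≤ i → i + 1 < n → s i * s (i+1) * s i = s (i+1) * s i * s (i+1)
  braid0 : 2 < n → s 0 * s 2 * s 0 = s 2 * s 0 * s 2

section basic
variable {G : Type*} [Group G]

lemma pow2_iff {a b : G} (ha : a * a = 1) (hb : b * b = 1) :
    (a * b) ^ 2 = 1 ↔ a * b = b * a := by
  have ha' : a⁻¹ = a := inv_eq_of_mul_eq_one_left ha
  have hb' : b⁻¹ = b := inv_eq_of_mul_eq_one_left hb
  rw [pow_two, mul_eq_one_iff_eq_inv]; simp [ha', hb']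

lemma pow3_iff {a b : G} (ha : a * a = 1) (hb : b * b = 1) :
    (a * b) ^ 3 = 1 ↔ a * b * a = b * a * b := by
  have ha' : a⁻¹ = a := inv_eq_of_mul_eq_one_left ha
  have hb' : b⁻¹ = b := inv_eq_of_mul_eq_one_left hb
  have : (a * b) ^ 3 = (a * b * a) * (b * a * b) := by simp only [pow_succ, pow_zero, one_mul, mul_assoc]
  rw [this, mul_eq_one_iff_eq_inv]; simp [ha', hb', mul_assoc]

lemma pow4_iff {a b : G} (ha : a * a = 1) (hb : b * b = 1) :
    (a * b) ^ 4 = 1 ↔ a * b * a * b = b * a * b * a := by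
  have ha' : a⁻¹ = a := inv_eq_of_mul_eq_one_left ha
  have hb' : b⁻¹ = b := inv_eq_of_mul_eq_one_left hb
  have : (a * b) ^ 4 = (a * b * a * b) * (a * b * a * b) := by simp only [pow_succ, pow_zero, one_mul, mul_assoc]
  rw [this, mul_eq_one_iff_eq_inv]; simp [ha', hb', mul_assoc]

lemma MB_apply (n : ℕ) (i j : Fin n) : MB n i j = if (i : ℕ) = (j : ℕ) then 1
    else if ((i : ℕ) = 0 ∧ (j : ℕ) = 1) ∨ ((i : ℕ) = 1 ∧ (j : ℕ) = 0) then 4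
    else if (1 ≤ (i : ℕ) ∧ 1 ≤ (j : ℕ)) ∧ ((i : ℕ) + 1 = (j : ℕ) ∨ (j : ℕ) + 1 = (i : ℕ)) then 3
    else 2 := rfl

lemma MD_apply (n : ℕ) (i j : Fin n) : MD n i j = if (i : ℕ) = (j : ℕ) then 1
    else if ((i : ℕ) = 0 ∧ (j : ℕ) = 2) ∨ ((i : ℕ) = 2 ∧ (j : ℕ) = 0) ∨
        ((i : ℕ) = 1 ∧ (j : ℕ) = 2) ∨ ((i : ℕ) = 2 ∧ (j : ℕ) = 1) ∨
        ((2 ≤ (i : ℕ) ∧ 2 ≤ (j : ℕ)) ∧ ((i : ℕ) + 1 = (j : ℕ) ∨ (j : ℕ) + 1 = (i : ℕ))) then 3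
    else 2 := rfl

lemma liftB {n : ℕ} {s : ℕ → G} (h : RelB n s) : (MB n).IsLiftable (fun i : Fin n => s i) := by
  rintro ⟨i, hi⟩ ⟨j, hj⟩
  rw [MB_apply]
  simp only
  have hi2 := h.sq i hi
  have hj2 := h.sq j hj
  split_ifs with h1 h2 h3
  · subst h1; simpa using hi2
  · rw [pow4_iff hi2 hj2]
    rcases h2 with ⟨rfl, rfl⟩ | ⟨rfl, rfl⟩
    · exact h.braid4 hj
    · exact (h.braid4 hi).symm
  · rw [pow3_iff hi2 hj2]
    obtain ⟨⟨h3, h4⟩, rfl | rfl⟩ := h3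
    · exact h.braid _ h3 hj
    · exact (h.braid _ h4 hi).symm
  · rw [pow2_iff hi2 hj2]
    rcases lt_or_gt_of_ne h1 with h5 | h5
    · exact h.comm _ _ (by omega) hj
    · exact (h.comm _ _ (by omega) hi).symm

lemma liftD {n : ℕ} {s : ℕ → G} (h : RelD n s) : (MD n).IsLiftable (fun i : Fin n => s i) := by
  rintro ⟨i, hi⟩ ⟨j, hj⟩
  rw [MD_apply]
  simp only
  have hi2 := h.sq i hi
  have hj2 := h.sq j hj
  split_ifs with h1 h2
  · subst h1; simpa using hi2
  · rw [pow3_iff hi2 hj2]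
    rcases h2 with ⟨rfl, rfl⟩ | ⟨rfl, rfl⟩ | ⟨rfl, rfl⟩ | ⟨rfl, rfl⟩ | ⟨⟨h3, h4⟩, rfl | rfl⟩
    · exact h.braid0 hj
    · exact (h.braid0 hi).symm
    · exact h.braid _ le_rfl hj
    · exact (h.braid _ le_rfl hi).symm
    · exact h.braid _ (by omega) hj
    · exact (h.braid _ (by omega) hi).symm
  · rw [pow2_iff hi2 hj2]
    rcases lt_or_gt_of_ne h1 with h5 | h5
    · by_cases h6 : i = 0 ∧ j = 1
      · obtain ⟨rfl, rfl⟩ := h6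
        exact h.comm0 hj
      · exact h.comm _ _ (by omega) hj (by omega)
    · by_cases h6 : j = 0 ∧ i = 1
      · obtain ⟨rfl, rfl⟩ := h6
        exact (h.comm0 hi).symm
      · exact (h.comm _ _ (by omega) hi (by omega)).symm

/-- generators indexed by naturals -/
def gen {n : ℕ} (M : CoxeterMatrix (Fin n)) (i : ℕ) : M.Group :=
  if h : i < n then M.simple ⟨i, h⟩ else 1

lemma gen_fin {n : ℕ} (M : CoxeterMatrix (Fin n)) (i : Fin n) : gen M i = M.simple i := by
  simp [gen]

lemma gen_pow {n : ℕ} (M : CoxeterMatrix (Fin n)) {i j : ℕ} (hi : i < n) (hj : j < n) :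
    (gen M i * gen M j) ^ (M ⟨i, hi⟩ ⟨j, hj⟩) = 1 := by
  simpa [gen, hi, hj] using M.toCoxeterSystem.simple_mul_simple_pow ⟨i, hi⟩ ⟨j, hj⟩

lemma gen_sq {n : ℕ} (M : CoxeterMatrix (Fin n)) (i : ℕ) : gen M i * gen M i = 1 := by
  by_cases hi : i < n
  · simpa [gen, hi] using M.toCoxeterSystem.simple_mul_simple_self ⟨i, hi⟩
  · simp [gen, hi]

lemma relB_gen (n : ℕ) : RelB n (gen (MB n)) where
  sq i _ := gen_sq _ i
  comm i j h hj := by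
    have := gen_pow (MB n) (show i < n by omega) hj
    rwa [MB_apply, if_neg (by simp; omega), if_neg (by simp; omega), if_neg (by simp; omega),
      pow2_iff (gen_sq _ _) (gen_sq _ _)] at this
  braid i h hj := by
    have := gen_pow (MB n) (show i < n by omega) hj
    rwa [MB_apply, if_neg (by simp), if_neg (by simp; omega), if_pos (by simp; omega),
      pow3_iff (gen_sq _ _) (gen_sq _ _)] at this
  braid4 h := by
    have := gen_pow (MB n) (show 0 < n by omega) h
    rwa [MB_apply, if_neg (by simp), if_pos (by simp),
      pow4_iff (gen_sq _ _) (gen_sq _ _)] at this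

lemma relD_gen (n : ℕ) : RelD n (gen (MD n)) where
  sq i _ := gen_sq _ i
  comm i j h hj h2 := by
    have := gen_pow (MD n) (show i < n by omega) hj
    rwa [MD_apply, if_neg (by simp; omega), if_neg (by simp; omega),
      pow2_iff (gen_sq _ _) (gen_sq _ _)] at this
  comm0 hj := by
    have := gen_pow (MD n) (show 0 < n by omega) hj
    rwa [MD_apply, if_neg (by simp), if_neg (by simp),
      pow2_iff (gen_sq _ _) (gen_sq _ _)] at this
  braid i h hj := by
    have := gen_pow (MD n) (show i < n by omega) hj
    rwa [MD_apply, if_neg (by simp), if_pos (by simp; omega),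
      pow3_iff (gen_sq _ _) (gen_sq _ _)] at this
  braid0 h := by
    have := gen_pow (MD n) (show 0 < n by omega) h
    rwa [MD_apply, if_neg (by simp), if_pos (by simp),
      pow3_iff (gen_sq _ _) (gen_sq _ _)] at this

lemma exists_homB {n : ℕ} {s : ℕ → G} (h : RelB n s) :
    ∃ f : (MB n).Group →* G, ∀ i < n, f (gen (MB n) i) = s i :=
  ⟨(MB n).toCoxeterSystem.lift ⟨_, liftB h⟩, fun i hi => by
    simpa [gen, hi] using (MB n).toCoxeterSystem.lift_apply_simple (liftB h) ⟨i, hi⟩⟩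

lemma exists_homD {n : ℕ} {s : ℕ → G} (h : RelD n s) :
    ∃ f : (MD n).Group →* G, ∀ i < n, f (gen (MD n) i) = s i :=
  ⟨(MD n).toCoxeterSystem.lift ⟨_, liftD h⟩, fun i hi => by
    simpa [gen, hi] using (MD n).toCoxeterSystem.lift_apply_simple (liftD h) ⟨i, hi⟩⟩

lemma closure_gen {n : ℕ} (M : CoxeterMatrix (Fin n)) :
    Subgroup.closure (gen M '' {i | i < n}) = ⊤ := by
  rw [← M.toCoxeterSystem.subgroup_closure_range_simple]
  congr 1
  ext x
  simp only [Set.mem_image, Set.mem_ofPred_eq, Set.mem_range, CoxeterMatrix.toCoxeterSystem_simple]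
  constructor
  · rintro ⟨i, hi, rfl⟩
    exact ⟨⟨i, hi⟩, by simp [gen, hi]⟩
  · rintro ⟨i, rfl⟩
    exact ⟨i, i.2, gen_fin M i⟩

lemma hom_ext {n : ℕ} {M : CoxeterMatrix (Fin n)} {f g : M.Group →* G}
    (h : ∀ i < n, f (gen M i) = g (gen M i)) : f = g := by
  apply M.toCoxeterSystem.ext_simple
  intro i
  simpa [gen_fin] using h i i.2

end basic

section upper
variable {G : Type*} [Group G]

def tt (k m : ℕ) : ℕ := if m ≤ k then k - m else m - k

def pp {X : Type*} [MulAction G X] (s : ℕ → G) (k : ℕ) (x : X) : ℕ → X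
  | 0 => x
  | m + 1 => s (tt k m) • pp s k x m

lemma fix {X : Type*} [MulAction G X] {n : ℕ} {s : ℕ → G} (h : RelB n s) {k : ℕ} (hk : k < n)
    (x : X) (hx : ∀ i < k, s i • x = x) (m : ℕ) : m ≤ 2 * k + 1 → ∀ i ≤ k,
    (m = 2 * k + 1 ∨ i ≠ tt k m) → (m = 0 ∨ i ≠ tt k (m-1)) → s i • pp s k x m = pp s k x m := by
  induction m using Nat.strong_induction_on with
  | _ m ih =>
  intro hm i hi h1 h2
  rcases m with _ | m
  · exact hx i (by simp [tt] at h1; omega)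
  · simp only [Nat.add_sub_cancel, Nat.add_eq_zero_iff, one_ne_zero, and_false, false_or] at h2
    by_cases hc : m = 0 ∨ i ≠ tt k (m-1)
    · have hcomm : s i * s (tt k m) = s (tt k m) * s i := by
        have : i + 1 < tt k m ∨ tt k m + 1 < i := by
          simp only [tt] at *
          split_ifs at * <;> omega
        rcases this with h' | h'
        · exact h.comm _ _ h' (by simp only [tt] at *; split_ifs at * <;> omega)
        · exact (h.comm _ _ h' (by omega)).symm
      have := ih m (by omega) (by omega) i hi (Or.inr h2) hc
      simp only [pp]
      rw [← mul_smul, hcomm, mul_smul, this]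
    · push Not at hc
      obtain ⟨hm0, rfl⟩ := hc
      obtain ⟨m, rfl⟩ := Nat.exists_eq_succ_of_ne_zero hm0
      simp only [Nat.succ_eq_add_one, Nat.add_sub_cancel] at *
      by_cases h0 : tt k m = 0
      · -- turning point
        have hmk : m = k := by simp only [tt] at h0; split_ifs at h0 <;> omega
        subst hmk
        have e1 : tt m (m+1) = 1 := by simp [tt]
        rcases m with _ | l
        · omega
        have e2 : tt (l+1) l = 1 := by simp [tt]
        have := ih l (by omega) (by omega) 0 (by omega) (Or.inr (by simp [e2]))
          (by simp only [tt]; split_ifs <;> omega)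
        simp only [pp, h0, e1, e2, ← mul_smul]
        rw [show s 0 * (s 1 * (s 0 * s 1)) = s 1 * s 0 * s 1 * s 0 by
          rw [← h.braid4 (by omega)]; simp only [mul_assoc], mul_smul, this]
        simp only [mul_assoc]
      · have hb : s (tt k m) * s (tt k (m+1)) * s (tt k m)
            = s (tt k (m+1)) * s (tt k m) * s (tt k (m+1)) := by
          have : (tt k (m+1) = tt k m + 1 ∧ 1 ≤ tt k m ∧ tt k (m+1) < n) ∨
              (tt k m = tt k (m+1) + 1 ∧ 1 ≤ tt k (m+1) ∧ tt k m < n) := by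
            simp only [tt] at *; split_ifs at * <;> omega
          rcases this with ⟨e, e1, e2⟩ | ⟨e, e1, e2⟩
          · rw [e] at e2 ⊢; exact h.braid _ e1 e2
          · rw [e] at e2 ⊢; exact (h.braid _ e1 e2).symm
        have := ih m (by omega) (by omega) (tt k (m+1))
          (by simp only [tt]; split_ifs <;> omega) (Or.inr (Ne.symm h2))
          (by simp only [tt] at *; split_ifs at * <;> omega)
        simp only [pp, ← mul_smul]
        rw [← mul_assoc, hb, mul_smul, this]

lemma stable {X : Type*} [MulAction G X] {n : ℕ} {s : ℕ → G} (h : RelB n s) {k : ℕ} (hk : k < n)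
    (x : X) (hx : ∀ i < k, s i • x = x) (m : ℕ) (hm : m < 2 * (k + 1)) (i : ℕ) (hi : i ≤ k) :
    ∃ m' < 2 * (k+1), s i • pp s k x m = pp s k x m' := by
  by_cases h1 : m = 2 * k + 1 ∨ i ≠ tt k m
  · by_cases h2 : m = 0 ∨ i ≠ tt k (m-1)
    · exact ⟨m, hm, fix h hk x hx m (by omega) i hi h1 h2⟩
    · push Not at h2
      obtain ⟨h2, rfl⟩ := h2
      obtain ⟨m, rfl⟩ := Nat.exists_eq_succ_of_ne_zero h2
      refine ⟨m, by omega, ?_⟩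
      simp only [Nat.succ_eq_add_one, Nat.add_sub_cancel, pp] at *
      rw [← mul_smul, h.sq _ (by omega), one_smul]
  · push Not at h1
    obtain ⟨h1, rfl⟩ := h1
    exact ⟨m+1, by omega, rfl⟩

lemma upper {n : ℕ} {s : ℕ → G} (h : RelB n s) (k : ℕ) (hk : k ≤ n) :
    Finite (Subgroup.closure (s '' {i | i < k})) ∧
    Nat.card (Subgroup.closure (s '' {i | i < k})) ≤ 2 ^ k * k.factorial := by
  induction k with
  | zero => simp [Subgroup.closure_empty]; infer_instance
  | succ k ih =>
    obtain ⟨hf, hc⟩ := ih (by omega)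
    set H := Subgroup.closure (s '' {i | i < k}) with hH
    set K := Subgroup.closure (s '' {i | i < k + 1}) with hK
    let x : G ⧸ H := QuotientGroup.mk 1
    have hx : ∀ i < k, s i • x = x := by
      intro i hi
      change QuotientGroup.mk (s i * 1) = (QuotientGroup.mk 1 : G ⧸ H)
      rw [eq_comm, QuotientGroup.eq]
      simpa using (Subgroup.subset_closure ⟨i, hi, rfl⟩ : s i ∈ Subgroup.closure (s '' {i | i < k}))
    have key : ∀ g ∈ K, ∀ m < 2 * (k+1), ∃ m' < 2 * (k+1), g • pp s k x m = pp s k x m' := by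
      intro g hg
      induction hg using Subgroup.closure_induction'' with
      | mem g hg =>
        obtain ⟨i, hi, rfl⟩ := hg
        intro m hm
        exact stable h hk x hx m hm i (Nat.lt_succ_iff.mp hi)
      | inv_mem g hg =>
        obtain ⟨i, hi, rfl⟩ := hg
        intro m hm
        rw [inv_eq_of_mul_eq_one_left (h.sq i (lt_of_lt_of_le hi hk))]
        exact stable h hk x hx m hm i (Nat.lt_succ_iff.mp hi)
      | one => intro m hm; exact ⟨m, hm, by simp⟩
      | mul a b _ _ ha hb =>
        intro m hm
        obtain ⟨m1, h1, e1⟩ := hb m hm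
        obtain ⟨m2, h2, e2⟩ := ha m1 h1
        exact ⟨m2, h2, by rw [mul_smul, e1, e2]⟩
    have key2 : ∀ g : K, ∃ p : Fin (2 * (k+1)) × H, (g : G) = (pp s k x p.1).out * p.2 := by
      intro g
      obtain ⟨m, hm, e⟩ := key g g.2 0 (by omega)
      have e' : (QuotientGroup.mk (g : G) : G ⧸ H) = pp s k x m := by
        rw [← e]; change _ = QuotientGroup.mk ((g : G) * 1); simp
      refine ⟨⟨⟨m, hm⟩, ⟨(pp s k x m).out⁻¹ * g, ?_⟩⟩, by simp⟩
      rw [← QuotientGroup.eq, e']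
      exact Quotient.out_eq' _
    choose F hF using key2
    have hinj : Function.Injective F := by
      intro a b hab
      apply Subtype.ext
      rw [hF a, hF b, hab]
    refine ⟨Finite.of_injective F hinj, (Nat.card_le_card_of_injective F hinj).trans ?_⟩
    rw [Nat.card_prod, Nat.card_fin, Nat.factorial_succ, pow_succ]
    calc 2 * (k+1) * Nat.card H ≤ 2 * (k+1) * (2 ^ k * k.factorial) := Nat.mul_le_mul_left _ hc
      _ = _ := by ring

lemma upperB (n : ℕ) : Finite (MB n).Group ∧ Nat.card (MB n).Group ≤ 2 ^ n * n.factorial := by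
  have := upper (relB_gen n) n le_rfl
  rw [closure_gen] at this
  refine ⟨?_, ?_⟩
  · have := this.1
    exact Finite.of_equiv _ Subgroup.topEquiv.toEquiv
  · rw [← Nat.card_congr Subgroup.topEquiv.toEquiv]; exact this.2
end upper

section lower
variable {G : Type*} [Group G]

open Equiv

def sp (k i : ℕ) : Perm (Fin (k+1)) := swap (Fin.ofNat (k+1) i) (Fin.ofNat (k+1) (i+1))

lemma ofNat_ne {k i j : ℕ} (hi : i ≤ k) (hj : j ≤ k) (h : i ≠ j) :
    Fin.ofNat (k+1) i ≠ Fin.ofNat (k+1) j := by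
  intro e
  have := congrArg Fin.val e
  simp only [Fin.ofNat, Nat.mod_eq_of_lt (Nat.lt_succ_of_le hi),
    Nat.mod_eq_of_lt (Nat.lt_succ_of_le hj)] at this
  exact h this

abbrev SG (k : ℕ) := (Fin (k+1) → ℤˣ) ⋊[mulAutArrow (G := Perm (Fin (k+1)))] Perm (Fin (k+1))

def sgen (k : ℕ) : ℕ → SG k
  | 0 => SemidirectProduct.inl (Pi.mulSingle 0 (-1))
  | i + 1 => SemidirectProduct.inr (sp k i)

lemma act_single (k : ℕ) (σ : Perm (Fin (k+1))) (i : Fin (k+1)) (u : ℤˣ) :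
    mulAutArrow σ (Pi.mulSingle i u : Fin (k+1) → ℤˣ) = Pi.mulSingle (σ i) u := by
  ext j
  change ((Pi.mulSingle i u : Fin (k+1) → ℤˣ) (σ⁻¹ j) : ℤ) = _
  simp only [Pi.mulSingle_apply, Perm.inv_eq_iff_eq]

lemma inr_inl (k : ℕ) (σ : Perm (Fin (k+1))) (v : Fin (k+1) → ℤˣ) :
    (SemidirectProduct.inr σ * SemidirectProduct.inl v : SG k) =
      SemidirectProduct.inl (mulAutArrow σ v) * SemidirectProduct.inr σ := by
  rw [SemidirectProduct.inl_aut]; simp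

lemma relB_sgen (k : ℕ) : RelB (k+1) (sgen k) where
  sq i hi := by
    rcases i with _ | i
    · simp only [sgen]
      rw [← map_mul, ← Pi.mulSingle_mul]; simp
    · simp only [sgen]
      rw [← map_mul, sp, swap_mul_self, map_one]
  comm i j h hj := by
    obtain ⟨j, rfl⟩ := Nat.exists_eq_succ_of_ne_zero (show j ≠ 0 by omega)
    rcases i with _ | i
    · simp only [sgen]
      rw [inr_inl, act_single]
      congr 3
      rw [sp, swap_apply_of_ne_of_ne]
      · exact ofNat_ne (i := 0) (by omega) (by omega) (by omega)
      · exact ofNat_ne (i := 0) (by omega) (by omega) (by omega)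
    · simp only [sgen]
      rw [← map_mul, ← map_mul]
      congr 1
      apply Perm.Disjoint.commute
      apply Perm.disjoint_swap_swap
      simp only [List.nodup_cons, List.mem_cons, List.not_mem_nil, or_false, not_or,
        List.nodup_nil, not_false_eq_true, and_true]
      refine ⟨⟨?_, ?_, ?_⟩, ⟨?_, ?_⟩, ?_⟩ <;> exact ofNat_ne (by omega) (by omega) (by omega)
  braid i hi hj := by
    obtain ⟨i, rfl⟩ := Nat.exists_eq_succ_of_ne_zero (show i ≠ 0 by omega)
    simp only [sgen]
    rw [← map_mul, ← map_mul, ← map_mul, ← map_mul]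
    congr 1
    have h1 := ofNat_ne (k := k) (i := i) (j := i+1) (by omega) (by omega) (by omega)
    have h2 := ofNat_ne (k := k) (i := i+1) (j := i+1+1) (by omega) (by omega) (by omega)
    have h3 := ofNat_ne (k := k) (i := i) (j := i+1+1) (by omega) (by omega) (by omega)
    simp only [sp, Nat.succ_eq_add_one]
    rw [swap_mul_swap_mul_swap h1 h3]
    rw [swap_comm (Fin.ofNat (k+1) i) (Fin.ofNat (k+1) (i+1)),
      swap_comm (Fin.ofNat (k+1) (i+1)) (Fin.ofNat (k+1) (i+1+1)),
      swap_mul_swap_mul_swap h2.symm h3.symm, swap_comm]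
  braid4 h := by
    simp only [sgen]
    have hs : sp k 0 * sp k 0 = 1 := swap_mul_self _ _
    set v : Fin (k+1) → ℤˣ := Pi.mulSingle 0 (-1)
    ext1
    · simp only [SemidirectProduct.mul_left, SemidirectProduct.mul_right, SemidirectProduct.left_inl,
        SemidirectProduct.left_inr, SemidirectProduct.right_inl, SemidirectProduct.right_inr,
        map_one, one_mul, mul_one, MulAut.one_apply, hs]
      exact mul_comm _ _
    · simp

lemma surj_sgen (k : ℕ) : ∃ f : (MB (k+1)).Group →* SG k, Function.Surjective f := by
  obtain ⟨f, hf⟩ := exists_homB (relB_sgen k)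
  refine ⟨f, ?_⟩
  rw [← MonoidHom.range_eq_top, eq_top_iff]
  have hr : ∀ σ : Perm (Fin (k+1)), SemidirectProduct.inr σ ∈ f.range := by
    intro σ
    have : (⊤ : Submonoid (Perm (Fin (k+1)))) ≤
        (f.range.comap (SemidirectProduct.inr)).toSubmonoid := by
      rw [← Perm.mclosure_swap_castSucc_succ, Submonoid.closure_le]
      rintro _ ⟨i, rfl⟩
      refine ⟨gen _ (i+1), ?_⟩
      rw [hf _ (by omega), sgen, sp]
      congr 2
      · ext; simp [Fin.ofNat]
      · ext; simp [Fin.ofNat]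
    exact this (Submonoid.mem_top σ)
  have h0 : SemidirectProduct.inl (Pi.mulSingle 0 (-1)) ∈ f.range := ⟨gen _ 0, hf 0 (by omega)⟩
  have hl : ∀ v : Fin (k+1) → ℤˣ, SemidirectProduct.inl v ∈ f.range := by
    intro v
    change v ∈ f.range.comap (SemidirectProduct.inl)
    apply Subgroup.pi_mem_of_mulSingle_mem
    intro i
    rcases Int.units_eq_one_or (v i) with h | h <;> rw [h]
    · simp [Subgroup.one_mem]
    · rw [Subgroup.mem_comap, ← swap_apply_left 0 i, ← act_single, SemidirectProduct.inl_aut]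
      exact mul_mem (mul_mem (hr _) h0) (hr _)
  intro x _
  rw [← SemidirectProduct.inl_left_mul_inr_right x]
  exact mul_mem (hl _) (hr _)

lemma cardB {n : ℕ} (hn : 1 ≤ n) :
    Finite (MB n).Group ∧ Nat.card (MB n).Group = 2 ^ n * n.factorial := by
  obtain ⟨hf, hc⟩ := upperB n
  refine ⟨hf, le_antisymm hc ?_⟩
  obtain ⟨k, rfl⟩ := Nat.exists_eq_succ_of_ne_zero (show n ≠ 0 by omega)
  obtain ⟨f, hs⟩ := surj_sgen k
  have := Nat.card_le_card_of_surjective f hs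
  rw [SemidirectProduct.card] at this
  refine le_trans (le_of_eq ?_) this
  simp [Nat.card_eq_fintype_card, Fintype.card_perm]

end lower

section typeD
variable {G : Type*} [Group G]

lemma exists_units_hom {a : G} (ha : a * a = 1) : ∃ u : ℤˣ →* G, u (-1) = a := by
  refine ⟨{ toFun := fun x => if x = 1 then 1 else a, map_one' := by simp, map_mul' := ?_ }, ?_⟩
  · intro x y
    rcases Int.units_eq_one_or x with rfl | rfl <;> rcases Int.units_eq_one_or y with rfl | rfl <;>
      simp [ha]
  · simp

def wD (n : ℕ) (i : ℕ) : (MD n).Group :=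
  if i = 0 then gen (MD n) 1 else if i = 1 then gen (MD n) 0 else gen (MD n) i

lemma relD_wD {n : ℕ} : RelD n (wD n) where
  sq i hi := by
    unfold wD; split_ifs <;> exact gen_sq _ _
  comm i j h hj h2 := by
    have R := relD_gen n
    obtain ⟨h3, h4⟩ : j ≠ 0 ∧ j ≠ 1 := by omega
    simp only [wD, h3, h4, if_false]
    split_ifs with h5 h6
    · exact R.comm 1 j (by omega) hj (by omega)
    · exact R.comm 0 j (by omega) hj (by omega)
    · exact R.comm _ _ h hj h2
  comm0 h := by
    simpa [wD] using ((relD_gen n).comm0 h).symm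
  braid i hi hj := by
    have R := relD_gen n
    by_cases h : i = 1
    · subst h; simpa [wD] using R.braid0 hj
    · simpa [wD, h, show i ≠ 0 by omega] using R.braid i hi hj
  braid0 h := by
    simpa [wD] using (relD_gen n).braid 1 le_rfl h

lemma exists_tau {n : ℕ} (hn : 2 ≤ n) : ∃ t : MulAut (MD n).Group, t * t = 1 ∧
    ∀ i < n, t (gen (MD n) i) = wD n i := by
  obtain ⟨f, hf⟩ := exists_homD (relD_wD (n := n))
  have hff : f.comp f = MonoidHom.id _ := by
    apply hom_ext
    intro i hi
    simp only [MonoidHom.comp_apply, MonoidHom.id_apply, hf i hi]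
    unfold wD
    split_ifs with h1 h2
    · rw [hf 1 (by omega)]; simp [wD, h1]
    · rw [hf 0 (by omega)]; simp [wD, h2]
    · rw [hf i hi]; simp [wD, h1, h2]
  refine ⟨MonoidHom.toMulEquiv f f hff hff, ?_, hf⟩
  ext x
  exact DFunLike.congr_fun hff x

def bD (n : ℕ) (i : ℕ) : (MB n).Group :=
  if i = 0 then gen (MB n) 0 * gen (MB n) 1 * gen (MB n) 0 else gen (MB n) i

lemma conj_simp {a b : G} (ha : a * a = 1) : a * (a * b) = b := by rw [← mul_assoc, ha, one_mul]

lemma relD_bD {n : ℕ} : RelD n (bD n) where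
  sq i hi := by
    unfold bD
    split_ifs
    · simp only [mul_assoc, conj_simp (gen_sq _ _), gen_sq]
    · exact gen_sq _ _
  comm i j h hj h2 := by
    have R := relB_gen n
    simp only [bD, show j ≠ 0 by omega, if_false]
    split_ifs with h3
    · have e0 := R.comm 0 j (by omega) hj
      have e1 := R.comm 1 j (by omega) hj
      exact (Commute.mul_left (Commute.mul_left e0 e1) e0)
    · exact R.comm i j h hj
  comm0 h := by
    have := (relB_gen n).braid4 h
    simpa [bD, mul_assoc] using this
  braid i hi hj := by
    simpa [bD, show i ≠ 0 by omega] using (relB_gen n).braid i hi hj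
  braid0 h := by
    have R := relB_gen n
    have e0 := R.comm 0 2 (by omega) h
    have e1 := R.braid 1 le_rfl h
    have q0 := gen_sq (MB n) 0
    simp only [bD, if_true, if_false, show (2:ℕ) ≠ 0 by omega]
    simp only [Nat.reduceAdd] at e1
    generalize gen (MB n) 0 = a at *
    generalize gen (MB n) 1 = b at *
    generalize gen (MB n) 2 = c at *
    calc a * b * a * c * (a * b * a) = a * b * (a * c) * a * b * a := by simp only [mul_assoc]
      _ = a * b * c * (a * a) * b * a := by rw [e0]; simp only [mul_assoc]
      _ = a * (b * c * b) * a := by rw [q0]; simp only [mul_assoc, one_mul]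
      _ = (a * c) * b * (c * a) := by rw [e1]; simp only [mul_assoc]
      _ = c * (a * b * a) * c := by rw [← e0, e0]; simp only [mul_assoc]; rw [e0]

lemma cardD {n : ℕ} (hn : 2 ≤ n) :
    Finite (MD n).Group ∧ Nat.card (MD n).Group = 2 ^ (n - 1) * n.factorial := by
  obtain ⟨hfin, hc⟩ := cardB (n := n) (by omega)
  obtain ⟨t, ht, htg⟩ := exists_tau hn
  obtain ⟨φ, hφ⟩ := exists_units_hom ht
  have RB := relB_gen n
  have RD := relD_gen n
  have t0 : t (gen (MD n) 0) = gen (MD n) 1 := by rw [htg 0 (by omega)]; simp [wD]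
  have t1 : t (gen (MD n) 1) = gen (MD n) 0 := by rw [htg 1 (by omega)]; simp [wD]
  -- the surjection from B
  let s : ℕ → (MD n).Group ⋊[φ] ℤˣ := fun i =>
    if i = 0 then SemidirectProduct.inr (-1) else SemidirectProduct.inl (gen (MD n) i)
  have Rs : RelB n s :=
    { sq := by
        intro i hi
        simp only [s]
        split_ifs
        · rw [← map_mul]; simp
        · rw [← map_mul, gen_sq, map_one]
      comm := by
        intro i j h hj
        simp only [s, show j ≠ 0 by omega, if_false]
        split_ifs with h0
        · have : t (gen (MD n) j) = gen (MD n) j := by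
            rw [htg j hj]; simp [wD, show j ≠ 0 by omega, show j ≠ 1 by omega]
          ext <;> simp [hφ, this]
        · rw [← map_mul, ← map_mul, RD.comm i j h hj (by omega)]
      braid := by
        intro i hi hj
        simp only [s, show i ≠ 0 by omega, show i + 1 ≠ 0 by omega, if_false]
        simp only [← map_mul]
        rw [RD.braid i hi hj]
      braid4 := by
        intro h
        simp only [s, if_true, if_false, one_ne_zero]
        ext
        · simp [hφ, t1, RD.comm0 h]
        · simp }
  obtain ⟨f, hf⟩ := exists_homB Rs
  have hfs : Function.Surjective f := by
    rw [← MonoidHom.range_eq_top, eq_top_iff]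
    have hm : SemidirectProduct.inr (-1) ∈ f.range := ⟨gen _ 0, by rw [hf 0 (by omega)]; simp [s]⟩
    have hr : ∀ u : ℤˣ, SemidirectProduct.inr u ∈ f.range := by
      intro u
      rcases Int.units_eq_one_or u with rfl | rfl
      · rw [map_one]; exact one_mem _
      · exact hm
    have hg : ∀ i, i ≠ 0 → i < n → SemidirectProduct.inl (gen (MD n) i) ∈ f.range :=
      fun i h0 hi => ⟨gen _ i, by rw [hf i hi]; simp [s, h0]⟩
    have hl : (⊤ : Subgroup (MD n).Group) ≤ f.range.comap SemidirectProduct.inl := by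
      rw [← closure_gen, Subgroup.closure_le]
      rintro _ ⟨i, hi, rfl⟩
      by_cases h0 : i = 0
      · subst h0
        change SemidirectProduct.inl _ ∈ f.range
        rw [← t1, ← hφ, SemidirectProduct.inl_aut]
        exact mul_mem (mul_mem hm (hg 1 one_ne_zero (by omega))) (hr _)
      · exact hg i h0 hi
    intro x _
    rw [← SemidirectProduct.inl_left_mul_inr_right x]
    exact mul_mem (hl (Subgroup.mem_top _)) (hr _)
  -- the surjection onto B
  obtain ⟨fn, hfn⟩ := exists_homD (relD_bD (n := n))
  obtain ⟨fg, hfg⟩ := exists_units_hom (gen_sq (MB n) 0)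
  have q0 := gen_sq (MB n) 0
  have i0 : (gen (MB n) 0)⁻¹ = gen (MB n) 0 := inv_eq_of_mul_eq_one_left q0
  have hcompat : ∀ g : ℤˣ, fn.comp (φ g).toMonoidHom = (MulAut.conj (fg g)).toMonoidHom.comp fn := by
    intro g
    rcases Int.units_eq_one_or g with rfl | rfl
    · ext; simp
    · apply hom_ext
      intro i hi
      simp only [MonoidHom.comp_apply, MulEquiv.coe_toMonoidHom, hφ, hfg, MulAut.conj_apply, i0]
      rw [htg i hi, hfn i hi]
      unfold wD
      split_ifs with h0 h1
      · rw [hfn 1 (by omega)]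
        simp only [bD, h0, if_true, if_false, one_ne_zero, mul_assoc, conj_simp q0, q0, mul_one]
      · rw [hfn 0 (by omega)]
        simp [bD, h1]
      · rw [hfn i hi]
        simp only [bD, h0, if_false]
        rw [RB.comm 0 i (by omega) hi, mul_assoc, q0, mul_one]
  let g := SemidirectProduct.lift fn fg hcompat
  have hgs : Function.Surjective g := by
    rw [← MonoidHom.range_eq_top, eq_top_iff, ← closure_gen, Subgroup.closure_le]
    rintro _ ⟨i, hi, rfl⟩
    by_cases h0 : i = 0
    · subst h0
      exact ⟨SemidirectProduct.inr (-1), by simp [g, hfg]⟩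
    · exact ⟨SemidirectProduct.inl (gen _ i), by simp [g, hfn i hi, bD, h0]⟩
  have hfinS : Finite ((MD n).Group ⋊[φ] ℤˣ) := Finite.of_surjective f hfs
  have c1 := Nat.card_le_card_of_surjective f hfs
  have c2 := Nat.card_le_card_of_surjective g hgs
  have c3 := le_antisymm c1 c2
  rw [SemidirectProduct.card, hc] at c3
  refine ⟨Finite.of_injective _ (SemidirectProduct.inl_injective (φ := φ)), ?_⟩
  have hu : Nat.card ℤˣ = 2 := by simp [Nat.card_eq_fintype_card]
  obtain ⟨k, rfl⟩ := Nat.exists_eq_succ_of_ne_zero (show n ≠ 0 by omega)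
  rw [hu, Nat.succ_eq_add_one, pow_succ] at c3
  rw [Nat.succ_eq_add_one, Nat.add_sub_cancel]
  have : Nat.card (MD (k+1)).Group * 2 = 2 ^ k * (k+1).factorial * 2 := by rw [c3]; ring
  exact Nat.eq_of_mul_eq_mul_right two_pos this

end typeD

end CoxBD

/-- the Coxeter group of type `Bₙ` (for `n ≥ 1`) is finite of cardinality
`2ⁿ · n!`, and the Coxeter group of type `Dₙ` (for `n ≥ 2`) is finite of cardinality
`2^(n-1) · n!`. -/
theorem card_coxeterB_and_coxeterD (n : ℕ) :
    (1 ≤ n → Finite (MB n).Group ∧ Nat.card (MB n).Group = 2 ^ n * n.factorial) ∧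
    (2 ≤ n → Finite (MD n).Group ∧ Nat.card (MD n).Group = 2 ^ (n - 1) * n.factorial) := by
  exact ⟨CoxBD.cardB, CoxBD.cardD⟩
end

section
/- Let n ≥ 2. The hyperoctahedral group Bₙ is generated by the set {s₀, t₁, …, t_{n−1}}, and the subgroup Dₙ' of even signed permutations is generated by the set {t₀, t₁, …, t_{n−1}}. -/
namespace HyperAux

/-- Coordinate permutation as a homomorphism. -/
def phi (n : ℕ) : Equiv.Perm (Fin n) →* Equiv.Perm (Fin n × ZMod 2) where
  toFun σ := Equiv.prodCongr σ (Equiv.refl _)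
  map_one' := by ext x <;> rfl
  map_mul' _ _ := by ext x <;> rfl

/-- Sign change by a vector. -/
def dd {n : ℕ} (f : Fin n → ZMod 2) : Equiv.Perm (Fin n × ZMod 2) where
  toFun x := (x.1, x.2 + f x.1)
  invFun x := (x.1, x.2 - f x.1)
  left_inv x := by simp
  right_inv x := by simp

@[simp] lemma phi_apply {n : ℕ} (σ : Equiv.Perm (Fin n)) (x) : phi n σ x = (σ x.1, x.2) := rfl
@[simp] lemma dd_apply {n : ℕ} (f : Fin n → ZMod 2) (x) : dd f x = (x.1, x.2 + f x.1) := rfl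

lemma dd_zero {n : ℕ} : dd (0 : Fin n → ZMod 2) = 1 := by
  ext x <;> simp

lemma dd_add {n : ℕ} (f g : Fin n → ZMod 2) : dd (f + g) = dd f * dd g := by
  refine Equiv.ext fun x => ?_
  simp only [dd_apply, Equiv.Perm.mul_apply, Pi.add_apply]
  rw [add_assoc, add_comm (f x.1)]

lemma conj_dd {n : ℕ} (σ : Equiv.Perm (Fin n)) (f : Fin n → ZMod 2) :
    phi n σ * dd f * (phi n σ)⁻¹ = dd (f ∘ σ.symm) := by
  rw [mul_inv_eq_iff_eq_mul]
  refine Equiv.ext fun x => ?_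
  simp

lemma z2 (e : ZMod 2) : e = 0 ∨ e = 1 := by revert e; decide

lemma mem_B {n : ℕ} (g : Equiv.Perm (Fin n × ZMod 2)) :
    g ∈ hyperB n ↔ ∀ i e, g (i, e + 1) = ((g (i, e)).1, (g (i, e)).2 + 1) := by
  rw [hyperB, Subgroup.mem_centralizer_singleton_iff, Equiv.ext_iff]
  simp [negPerm, Prod.map]

lemma phi_mem {n : ℕ} (σ : Equiv.Perm (Fin n)) : phi n σ ∈ hyperB n := by
  rw [mem_B]; simp

lemma dd_mem {n : ℕ} (f : Fin n → ZMod 2) : dd f ∈ hyperB n := by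
  rw [mem_B]; intros; simp [add_right_comm]

lemma decomp {n : ℕ} (g : Equiv.Perm (Fin n × ZMod 2)) (hg : g ∈ hyperB n) :
    ∃ σ f, g = phi n σ * dd f := by
  rw [mem_B] at hg
  have hinj : Function.Injective (fun i => (g (i, 0)).1) := by
    intro i j hij
    simp only at hij
    have h1 := hg j 0
    by_cases h : (g (i, 0)).2 = (g (j, 0)).2
    · have := g.injective (Prod.ext hij h)
      simpa using this
    · have h2 : (g (i,0)).2 = (g (j,0)).2 + 1 := by
        clear h1
        generalize (g (i,0)).2 = a at *
        generalize (g (j,0)).2 = b at *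
        revert a b; decide
      have h3 : g (i,0) = g (j, 0 + 1) := by rw [h1]; exact Prod.ext hij h2
      have := g.injective h3
      simp at this
  refine ⟨Equiv.ofBijective _ (Finite.injective_iff_bijective.mp hinj), fun i => (g (i,0)).2, ?_⟩
  refine Equiv.ext ?_
  rintro ⟨i, e⟩
  rcases z2 e with rfl | rfl
  · simp
  · have := hg i 0
    simp only [zero_add] at this
    simp [this, add_comm]

lemma swap_eq {n : ℕ} (a b : Fin n) :
    Equiv.swap (a, (0 : ZMod 2)) (b, 0) * Equiv.swap (a, (1 : ZMod 2)) (b, 1) =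
      phi n (Equiv.swap a b) := by
  refine Equiv.ext ?_
  rintro ⟨k, e⟩
  rcases z2 e with rfl | rfl <;>
  · simp only [Equiv.Perm.mul_apply, phi_apply, Equiv.swap_apply_def]
    split_ifs <;> simp_all

lemma tGen_eq (n i : ℕ) (h1 : 1 ≤ i) (h2 : i < n) :
    tGen n i h1 h2 = phi n (Equiv.swap ⟨i - 1, by omega⟩ ⟨i, h2⟩) := swap_eq _ _

lemma sZero_eq (n : ℕ) (hn : 1 ≤ n) : sZero n hn = dd (Pi.single ⟨0, hn⟩ 1) := by
  refine Equiv.ext ?_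
  rintro ⟨k, e⟩
  rcases z2 e with rfl | rfl <;>
  · simp only [sZero, dd_apply, Equiv.swap_apply_def, Pi.single_apply]
    split_ifs <;> simp_all <;> decide

lemma tZero_eq (n : ℕ) (hn : 2 ≤ n) : tZero n hn =
    dd (Pi.single ⟨0, by omega⟩ 1 + Pi.single ⟨1, hn⟩ 1) *
      phi n (Equiv.swap ⟨0, by omega⟩ ⟨1, hn⟩) := by
  refine Equiv.ext ?_
  rintro ⟨k, e⟩
  rcases z2 e with rfl | rfl <;>
  · simp only [tZero, dd_apply, phi_apply, Equiv.Perm.mul_apply, Equiv.swap_apply_def, Pi.single_apply, Pi.add_apply]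
    split_ifs <;> simp_all <;> decide

lemma phi_in {n : ℕ} (K : Subgroup (Equiv.Perm (Fin n × ZMod 2)))
    (hK : ∀ i h1 h2, tGen n i h1 h2 ∈ K) (σ : Equiv.Perm (Fin n)) : phi n σ ∈ K := by
  cases n with
  | zero => rw [Subsingleton.elim σ 1, map_one]; exact one_mem _
  | succ m =>
    have h : (⊤ : Submonoid (Equiv.Perm (Fin (m+1)))) ≤ (K.comap (phi (m+1))).toSubmonoid := by
      rw [← Equiv.Perm.mclosure_swap_castSucc_succ, Submonoid.closure_le]
      rintro _ ⟨i, rfl⟩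
      have := hK (i.1+1) (by omega) (by omega)
      rw [tGen_eq] at this
      exact this
    exact h (Submonoid.mem_top σ)

lemma dd_conj_in {n : ℕ} (K : Subgroup (Equiv.Perm (Fin n × ZMod 2)))
    (hK : ∀ i h1 h2, tGen n i h1 h2 ∈ K) (σ : Equiv.Perm (Fin n)) (f : Fin n → ZMod 2)
    (hf : dd f ∈ K) : dd (f ∘ σ.symm) ∈ K := by
  rw [← conj_dd]
  exact mul_mem (mul_mem (phi_in K hK σ) hf) (inv_mem (phi_in K hK σ))

lemma vec_ind {n : ℕ} (P : (Fin n → ZMod 2) → Prop) (h0 : P 0)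
    (hs : ∀ i, P (Pi.single i 1)) (ha : ∀ f g, P f → P g → P (f + g)) (f) : P f := by
  rw [← Finset.univ_sum_single f]
  refine Finset.sum_induction _ P ha h0 fun i _ => ?_
  rcases z2 (f i) with h | h <;> rw [h]
  · simpa using h0
  · exact hs i

lemma single_comp {n : ℕ} (i j : Fin n) (σ : Equiv.Perm (Fin n)) (h : σ i = j) :
    (Pi.single i (1 : ZMod 2) : Fin n → ZMod 2) ∘ σ.symm = Pi.single j 1 := by
  subst h
  ext k
  simp [Pi.single_apply, Equiv.symm_apply_eq]

lemma add_self' {n : ℕ} (f : Fin n → ZMod 2) : f + f = 0 := by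
  ext i
  simp only [Pi.add_apply, Pi.zero_apply]
  generalize f i = a
  revert a; decide

end HyperAux

open HyperAux

/-- `Bₙ` is generated by `{s₀, t₁, …, t_{n-1}}` and `Dₙ'` is generated by
`{t₀, t₁, …, t_{n-1}}`. -/
theorem hyperB_hyperD_generators (n : ℕ) (hn : 2 ≤ n) :
    Subgroup.closure
        {g : Equiv.Perm (Fin n × ZMod 2) |
          g = sZero n (Nat.le_trans one_le_two hn) ∨
          ∃ (i : ℕ) (h1 : 1 ≤ i) (h2 : i < n), g = tGen n i h1 h2}
      = hyperB n ∧
    Subgroup.closure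
        {g : Equiv.Perm (Fin n × ZMod 2) |
          g = tZero n hn ∨
          ∃ (i : ℕ) (h1 : 1 ≤ i) (h2 : i < n), g = tGen n i h1 h2}
      = hyperD n := by
  have hn0 : 0 < n := by omega
  constructor
  · apply le_antisymm
    · rw [Subgroup.closure_le]
      rintro g (rfl | ⟨i, h1, h2, rfl⟩)
      · rw [sZero_eq]; exact dd_mem _
      · rw [tGen_eq]; exact phi_mem _
    · intro g hg
      set K := Subgroup.closure
        {g : Equiv.Perm (Fin n × ZMod 2) |
          g = sZero n (Nat.le_trans one_le_two hn) ∨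
          ∃ (i : ℕ) (h1 : 1 ≤ i) (h2 : i < n), g = tGen n i h1 h2} with hKd
      have hK : ∀ i h1 h2, tGen n i h1 h2 ∈ K := fun i h1 h2 =>
        Subgroup.subset_closure (Or.inr ⟨i, h1, h2, rfl⟩)
      have hs : dd (Pi.single ⟨0, hn0⟩ 1) ∈ K := by
        rw [← sZero_eq n hn0]
        exact Subgroup.subset_closure (Or.inl rfl)
      obtain ⟨σ, f, rfl⟩ := decomp g hg
      refine mul_mem (phi_in K hK σ) ?_
      refine vec_ind (fun f => dd f ∈ K) ?_ ?_ ?_ f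
      · rw [dd_zero]; exact one_mem _
      · intro i
        have := dd_conj_in K hK (Equiv.swap ⟨0, hn0⟩ i) _ hs
        rwa [single_comp _ i _ (by simp)] at this
      · intro f g hf hg
        rw [dd_add]; exact mul_mem hf hg
  · have hle : Subgroup.closure
        {g : Equiv.Perm (Fin n × ZMod 2) |
          g = tZero n hn ∨
          ∃ (i : ℕ) (h1 : 1 ≤ i) (h2 : i < n), g = tGen n i h1 h2}
      ≤ hyperD n := by
      rw [Subgroup.closure_le]
      rintro g (rfl | ⟨i, h1, h2, rfl⟩)
      · refine ⟨?_, ?_⟩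
        · rw [tZero_eq]; exact mul_mem (dd_mem _) (phi_mem _)
        · simp [tZero, Equiv.Perm.mem_alternatingGroup, Equiv.Perm.sign_swap']
      · refine ⟨?_, ?_⟩
        · rw [tGen_eq]; exact phi_mem _
        · have hne : i - 1 ≠ i := by omega
          simp [tGen, Equiv.Perm.mem_alternatingGroup, Equiv.Perm.sign_swap', hne]
    apply le_antisymm hle
    intro g hg
    set K := Subgroup.closure
        {g : Equiv.Perm (Fin n × ZMod 2) |
          g = tZero n hn ∨
          ∃ (i : ℕ) (h1 : 1 ≤ i) (h2 : i < n), g = tGen n i h1 h2} with hKd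
    have hK : ∀ i h1 h2, tGen n i h1 h2 ∈ K := fun i h1 h2 =>
      Subgroup.subset_closure (Or.inr ⟨i, h1, h2, rfl⟩)
    have ht : tZero n hn ∈ K := Subgroup.subset_closure (Or.inl rfl)
    rw [tZero_eq, Subgroup.mul_mem_cancel_right _ (phi_in K hK _)] at ht
    obtain ⟨σ, f, rfl⟩ := decomp g hg.1
    refine mul_mem (phi_in K hK σ) ?_
    have hφ := hle (phi_in K hK σ)
    have hf : dd f ∈ hyperD n := (Subgroup.mul_mem_cancel_left _ hφ).1 hg
    have key : dd f ∈ K ∨ dd (f + Pi.single ⟨0, hn0⟩ 1) ∈ K := by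
      refine vec_ind (fun f => dd f ∈ K ∨ dd (f + Pi.single ⟨0, hn0⟩ 1) ∈ K) ?_ ?_ ?_ f
      · left; rw [dd_zero]; exact one_mem _
      · intro i
        right
        by_cases hi : i = ⟨0, hn0⟩
        · rw [hi, add_self', dd_zero]; exact one_mem _
        · have h := dd_conj_in K hK (Equiv.swap ⟨1, hn⟩ i) _ ht
          rw [Pi.add_comp, single_comp _ i _ (Equiv.swap_apply_left _ _),
            single_comp _ ⟨0, hn0⟩ _
              (Equiv.swap_apply_of_ne_of_ne (by simp) (Ne.symm hi)), add_comm] at h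
          exact h
      · rintro f g (hf | hf) (hg | hg)
        · left; rw [dd_add]; exact mul_mem hf hg
        · right; rw [add_assoc, dd_add]; exact mul_mem hf hg
        · right; rw [add_right_comm, dd_add]; exact mul_mem hf hg
        · left
          have h := mul_mem hf hg
          rwa [← dd_add, add_add_add_comm, add_self', add_zero] at h
    rcases key with h | h
    · exact h
    · exfalso
      have h2 := hle h
      rw [dd_add, Subgroup.mul_mem_cancel_left _ hf, ← sZero_eq n hn0] at h2
      have h3 := h2.2
      simp [sZero, Equiv.Perm.mem_alternatingGroup, Equiv.Perm.sign_swap'] at h3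
end

section
/- Work in the polynomial ring R = MvPolynomial (ι ⊕ ι) (ZMod 2) for a type ι, writing X i and Y i for the variables indexed by the left and right copies of i. For a finite set T of indices, define h(T) = Σ over subsets S ⊆ T with |S| even of (∏_{i ∈ T \ S} (X i + Y i)) · (∏_{j ∈ S} X j). Then for every finite set T and every index a ∉ T, one has h(T ∪ {a}) = h(T) · (X a + Y a) + (∏_{i ∈ T} Y i + h(T)) · X a. (This is the identity hₙ = h_{n−1} ⊗ h₁ + (d₁^{⊗(n−1)} + h_{n−1}) ⊗ (d₁ + h₁) in H*(A_{(2)}^{⊗n}; ℤ/2) = ℤ/2[x₁, y₁, …, xₙ, yₙ], where h₁ = x + y and d₁ = y in each tensor factor.) -/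
open MvPolynomial

/-- The polynomial `h(T) = Σ_{S ⊆ T, |S| even} (∏_{i ∈ T \\ S} (X i + Y i)) · (∏_{j ∈ S} X j)`
in `ℤ/2[Xᵢ, Yᵢ]`, where `X i` and `Y i` are the variables indexed by the left and right
copies of `i`. -/
noncomputable def hPoly {ι : Type*} [DecidableEq ι] (T : Finset ι) :
    MvPolynomial (ι ⊕ ι) (ZMod 2) :=
  ∑ S ∈ T.powerset.filter (fun S => Even S.card),
    (∏ i ∈ T \ S, (X (Sum.inl i) + X (Sum.inr i))) * ∏ j ∈ S, X (Sum.inl j)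

theorem hPoly_aux_odd {ι : Type*} [DecidableEq ι] (T : Finset ι) :
    (∑ S ∈ T.powerset.filter (fun S => ¬ Even S.card),
      (∏ i ∈ T \ S, (X (Sum.inl i) + X (Sum.inr i))) * ∏ j ∈ S, X (Sum.inl j) :
      MvPolynomial (ι ⊕ ι) (ZMod 2)) = (∏ i ∈ T, X (Sum.inr i)) + hPoly T := by
  have h1 := Finset.sum_filter_add_sum_filter_not T.powerset (fun S => Even S.card)
    (fun S => (∏ i ∈ T \ S, (X (Sum.inl i) + X (Sum.inr i))) * ∏ j ∈ S, X (Sum.inl j) :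
      Finset ι → MvPolynomial (ι ⊕ ι) (ZMod 2))
  have h2 := Finset.prod_add (fun i => (X (Sum.inl i) : MvPolynomial (ι ⊕ ι) (ZMod 2)))
    (fun i => X (Sum.inl i) + X (Sum.inr i)) T
  have h3 : (∏ i ∈ T, (X (Sum.inl i) + (X (Sum.inl i) + X (Sum.inr i))) :
      MvPolynomial (ι ⊕ ι) (ZMod 2)) = ∏ i ∈ T, X (Sum.inr i) := by
    refine Finset.prod_congr rfl fun i _ => ?_
    rw [← add_assoc, CharTwo.add_self_eq_zero, zero_add]
  rw [h3] at h2
  simp only [mul_comm (∏ i ∈ _, X (Sum.inl i))] at h2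
  rw [h2, ← h1, hPoly, add_right_comm, CharTwo.add_self_eq_zero, zero_add]

/-- the recursion
`h(T ∪ {a}) = h(T)·(X a + Y a) + ((∏_{i ∈ T} Y i) + h(T))·X a` for `a ∉ T`. -/
theorem hPoly_union_singleton {ι : Type*} [DecidableEq ι] (T : Finset ι) (a : ι)
    (ha : a ∉ T) :
    hPoly (T ∪ {a})
      = hPoly T * (X (Sum.inl a) + X (Sum.inr a)) +
        ((∏ i ∈ T, X (Sum.inr i)) + hPoly T) * X (Sum.inl a) := by
  rw [← hPoly_aux_odd, Finset.union_comm, ← Finset.insert_eq]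
  unfold hPoly
  simp only [Finset.sum_filter]
  rw [Finset.sum_powerset_insert ha, Finset.sum_mul, Finset.sum_mul]
  congr 1
  · refine Finset.sum_congr rfl fun S hS => ?_
    have hS' := Finset.mem_powerset.1 hS
    have haS : a ∉ S := fun h => ha (hS' h)
    rw [Finset.insert_sdiff_of_notMem _ haS, Finset.prod_insert (by simp [ha])]
    split_ifs
    · ring
    · simp
  · refine Finset.sum_congr rfl fun S hS => ?_
    have hS' := Finset.mem_powerset.1 hS
    have haS : a ∉ S := fun h => ha (hS' h)
    have e : insert a T \ insert a S = T \ S := by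
      ext x
      simp only [Finset.mem_sdiff, Finset.mem_insert]
      grind
    rw [e, Finset.prod_insert haS, Finset.card_insert_of_notMem haS]
    simp only [Nat.even_add_one]
    split_ifs
    · simp
    · ring
end
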